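/- (Automata for coalgebraic MSO) Let T be a set functor and Λ a set of monotone predicate liftings for T. For every formula φ of the coalgebraic monadic second-order logic MSO_Λ with free variables contained in a finite set P, there exists a P-chromatic second-order Λ-automaton 𝔸_φ ∈ Aut(SO_Λ) that is equivalent to φ over T-tree models: for every T-tree model (S,R,σ,V,u), 𝔸_φ accepts (S,R,σ,V,u) if and only if (S,σ,V,u) ⊨ φ. -/

import Mathlib

open scoped Classical

/-- A set functor: an endofunctor on the category of sets (types in `Type`). -/
structure SetFunctor where
  obj : Type → Type
  map : {X Y : Type} → (X → Y) → obj X → obj Y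
  map_id : ∀ {X : Type} (x : obj X), map id x = x
  map_comp : ∀ {X Y Z : Type} (f : X → Y) (g : Y → Z) (x : obj X),
    map (g ∘ f) x = map g (map f x)

/-- An `n`-place predicate lifting for `T`: a natural transformation `𝒬(-)ⁿ → 𝒬 ∘ T`. -/
structure PredLifting (T : SetFunctor) (n : ℕ) where
  app : (X : Type) → (Fin n → Set X) → Set (T.obj X)
  natural : ∀ {X Y : Type} (f : X → Y) (V : Fin n → Set Y),
    app X (fun i => f ⁻¹' V i) = T.map f ⁻¹' app Y V

/-- Monotonicity of a predicate lifting. -/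
def PredLifting.Mono {T : SetFunctor} {n : ℕ} (l : PredLifting T n) : Prop :=
  ∀ (X : Type) (V V' : Fin n → Set X), (∀ i, V i ⊆ V' i) → l.app X V ⊆ l.app X V'

/-- A set `Λ` of monotone predicate liftings for `T`, presented as an indexed family. -/
structure LiftingFamily (T : SetFunctor) where
  ι : Type
  ar : ι → ℕ
  lf : (i : ι) → PredLifting T (ar i)
  mono : ∀ i, (lf i).Mono

/-- A generalized predicate lifting over a set `A` of variables. -/
structure GenLifting (T : SetFunctor) (A : Type) where
  app : (X : Type) → (A → Set X) → Set (T.obj X)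

/-- Monotonicity for generalized predicate liftings. -/
def GenLifting.Mono {T : SetFunctor} {A : Type} (φ : GenLifting T A) : Prop :=
  ∀ (X : Type) (V V' : A → Set X), (∀ a : A, V a ⊆ V' a) → φ.app X V ⊆ φ.app X V'

/-- Naturality for generalized predicate liftings. -/
def GenLifting.Natural {T : SetFunctor} {A : Type} (φ : GenLifting T A) : Prop :=
  ∀ (X Y : Type) (f : X → Y) (V : A → Set Y),
    φ.app X (fun a => f ⁻¹' V a) = T.map f ⁻¹' φ.app Y V

/-- Formulas of the one-step second-order language over variables `W`
(relative to the liftings in `F`). -/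
inductive SOForm {T : SetFunctor} (F : LiftingFamily T) (W : Type) : Type
  | subset (a b : W)
  | lift (i : F.ι) (v : Fin (F.ar i) → W)
  | neg (φ : SOForm F W)
  | or (φ ψ : SOForm F W)
  | ex (w : W) (φ : SOForm F W)

/-- Updating a valuation at one variable. -/
noncomputable def updW {W X : Type} (V : W → Set X) (w : W) (Z : Set X) : W → Set X :=
  fun w' => if w' = w then Z else V w'

/-- One-step satisfaction of second-order one-step formulas in a one-step model `(X, α, V)`. -/
def SOForm.sat {T : SetFunctor} {F : LiftingFamily T} {W : Type} (X : Type) (α : T.obj X) :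
    SOForm F W → (W → Set X) → Prop
  | .subset a b, V => V a ⊆ V b
  | .lift i v, V => α ∈ (F.lf i).app X (fun k => V (v k))
  | .neg φ, V => ¬ φ.sat X α V
  | .or φ ψ, V => φ.sat X α V ∨ ψ.sat X α V
  | .ex w φ, V => ∃ Z : Set X, φ.sat X α (updW V w Z)

/-- Free variables of a one-step second-order formula. -/
def SOForm.fv {T : SetFunctor} {F : LiftingFamily T} {W : Type} : SOForm F W → Set W
  | .subset a b => {a, b}
  | .lift _ v => Set.range v
  | .neg φ => φ.fv
  | .or φ ψ => φ.fv ∪ ψ.fv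
  | .ex w φ => φ.fv \ {w}

/-- Quantifier depth of a one-step second-order formula. -/
def SOForm.qd {T : SetFunctor} {F : LiftingFamily T} {W : Type} : SOForm F W → ℕ
  | .subset _ _ => 0
  | .lift _ _ => 0
  | .neg φ => φ.qd
  | .or φ ψ => max φ.qd ψ.qd
  | .ex _ φ => φ.qd + 1

/-- A one-step second-order sentence over `A`: a formula over `A ⊕ ℕ` all of whose
free variables come from `A`. -/
def IsSentence {T : SetFunctor} {F : LiftingFamily T} {A : Type}
    (φ : SOForm F (A ⊕ ℕ)) : Prop :=
  ∀ w ∈ φ.fv, ∃ a : A, w = Sum.inl a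

/-- Satisfaction of a sentence over `A` at a one-step model `(X, α, V)` with
`V : A → Set X` (bound variables are initialized arbitrarily). -/
def SOForm.sat0 {T : SetFunctor} {F : LiftingFamily T} {A : Type} (X : Type) (α : T.obj X)
    (φ : SOForm F (A ⊕ ℕ)) (V : A → Set X) : Prop :=
  φ.sat X α (Sum.elim V (fun _ => (∅ : Set X)))

/-- The generalized predicate lifting induced by a one-step second-order sentence. -/
def SOForm.toLifting {T : SetFunctor} {F : LiftingFamily T} {A : Type}
    (φ : SOForm F (A ⊕ ℕ)) : GenLifting T A :=
  ⟨fun X V => {α : T.obj X | φ.sat0 X α V}⟩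

/-- `RPath R s t l`: `l` is the list of successive nodes (after `s`) of an `R`-path
from `s` to `t`. -/
inductive RPath {S : Type} (R : S → S → Prop) : S → S → List S → Prop
  | nil (s : S) : RPath R s s []
  | cons {s t w : S} {l : List S} : R s t → RPath R t w l → RPath R s w (t :: l)

/-- A `T`-tree model: a `T`-model with a supporting Kripke frame `R` (witnessed by the
local coalgebra structure `σloc`) such that `(S,R)` is a tree rooted at `root`. -/
structure TreeModel (T : SetFunctor) where
  S : Type
  σ : S → T.obj S
  V : ℕ → Set S
  R : S → S → Prop
  root : S
  σloc : (s : S) → T.obj {t : S // R s t}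
  σloc_spec : ∀ s : S, T.map (Subtype.val) (σloc s) = σ s
  tree : ∀ w : S, ∃! l : List S, RPath R root w l

/-- A `P`-chromatic second-order `Λ`-automaton. -/
structure SOAutomaton (T : SetFunctor) (F : LiftingFamily T) where
  P : Set ℕ
  Pfin : P.Finite
  St : Type
  fin : Finite St
  aI : St
  Ω : St → ℕ
  Δ : St → Set ℕ → SOForm F (St ⊕ ℕ)
  sentence : ∀ (a : St) (c : Set ℕ), IsSentence (Δ a c)

/-- The colour of a state of a tree model. -/
def SOAutomaton.color {T : SetFunctor} {F : LiftingFamily T} (aut : SOAutomaton T F)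
    (M : TreeModel T) (s : M.S) : Set ℕ :=
  {p | p ∈ aut.P ∧ s ∈ M.V p}

/-- Legality of ∃'s moves in the acceptance game. -/
def SOAutomaton.Legal {T : SetFunctor} {F : LiftingFamily T} (aut : SOAutomaton T F)
    (M : TreeModel T) (a : aut.St) (s : M.S) (U : aut.St → Set M.S) : Prop :=
  (∀ b : aut.St, U b ⊆ {t : M.S | M.R s t}) ∧
  (aut.Δ a (aut.color M s)).sat0 {t : M.S // M.R s t} (M.σloc s)
    (fun b => {t : {t' : M.S // M.R s t'} | t.1 ∈ U b})

/-- Histories of the acceptance game reachable under strategy `st`. -/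
inductive SOReach {T : SetFunctor} {F : LiftingFamily T} (aut : SOAutomaton T F)
    (M : TreeModel T) (st : List (aut.St × M.S) → aut.St → Set M.S) :
    List (aut.St × M.S) → Prop
  | base : SOReach aut M st [(aut.aI, M.root)]
  | step {h : List (aut.St × M.S)} {p q : aut.St × M.S} :
      SOReach aut M st (p :: h) → q.2 ∈ st (p :: h) q.1 → SOReach aut M st (q :: p :: h)

/-- The history (most recent first) of the first `n+1` positions of a play. -/
def histPrefix {α : Type} (f : ℕ → α) (n : ℕ) : List α :=
  ((List.range (n + 1)).map f).reverse

/-- ∃ wins an infinite match iff the maximal parity occurring infinitely often is even. -/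
def SOAutomaton.WinsParity {T : SetFunctor} {F : LiftingFamily T} (aut : SOAutomaton T F)
    (M : TreeModel T) (f : ℕ → aut.St × M.S) : Prop :=
  ∃ n : ℕ, Even n ∧ (∃ᶠ i in Filter.atTop, aut.Ω (f i).1 = n) ∧
    ∀ m : ℕ, (∃ᶠ i in Filter.atTop, aut.Ω (f i).1 = m) → m ≤ n

/-- Acceptance of a `T`-tree model by a second-order automaton. -/
def SOAutomaton.Accepts {T : SetFunctor} {F : LiftingFamily T} (aut : SOAutomaton T F)
    (M : TreeModel T) : Prop :=
  ∃ st : List (aut.St × M.S) → aut.St → Set M.S,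
    (∀ (h : List (aut.St × M.S)) (a : aut.St) (s : M.S),
        SOReach aut M st ((a, s) :: h) → aut.Legal M a s (st ((a, s) :: h))) ∧
    (∀ f : ℕ → aut.St × M.S, f 0 = (aut.aI, M.root) →
        (∀ n : ℕ, (f (n + 1)).2 ∈ st (histPrefix f n) (f (n + 1)).1) →
        aut.WinsParity M f)

/-- Formulas of coalgebraic monadic second-order logic `MSO_Λ`. -/
inductive MSOForm {T : SetFunctor} (F : LiftingFamily T) : Type
  | bot
  | sr (p : ℕ)
  | subset (p q : ℕ)
  | lift (i : F.ι) (p : ℕ) (q : Fin (F.ar i) → ℕ)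
  | or (φ ψ : MSOForm F)
  | neg (φ : MSOForm F)
  | ex (p : ℕ) (φ : MSOForm F)

/-- Satisfaction of `MSO_Λ`-formulas in a pointed `T`-model. -/
def MSOForm.sat {T : SetFunctor} {F : LiftingFamily T} {S : Type} (σ : S → T.obj S) :
    MSOForm F → (ℕ → Set S) → S → Prop
  | .bot, _, _ => False
  | .sr p, V, u => V p = {u}
  | .subset p q, V, _ => V p ⊆ V q
  | .lift i p qs, V, _ => ∀ v ∈ V p, σ v ∈ (F.lf i).app S (fun k => V (qs k))
  | .or φ ψ, V, u => φ.sat σ V u ∨ ψ.sat σ V u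
  | .neg φ, V, u => ¬ φ.sat σ V u
  | .ex p φ, V, u => ∃ Z : Set S, φ.sat σ (updW V p Z) u

/-- Free variables of an `MSO_Λ`-formula. -/
def MSOForm.fv {T : SetFunctor} {F : LiftingFamily T} : MSOForm F → Set ℕ
  | .bot => ∅
  | .sr p => {p}
  | .subset p q => {p, q}
  | .lift _ p qs => {p} ∪ Set.range qs
  | .or φ ψ => φ.fv ∪ ψ.fv
  | .neg φ => φ.fv
  | .ex p φ => φ.fv \ {p}

/-- The largest number occurring infinitely often in `g` exists and has the parity of `e`. -/
def PWins (e : ℕ) (g : ℕ → ℕ) : Prop :=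
  ∃ n : ℕ, Even (n + e) ∧ (∃ᶠ i in Filter.atTop, g i = n) ∧
    ∀ m : ℕ, (∃ᶠ i in Filter.atTop, g i = m) → m ≤ n

theorem PWins.add_two {e : ℕ} {g : ℕ → ℕ} : PWins (e + 2) g ↔ PWins e g := by
  unfold PWins
  simp only [← add_assoc, Nat.even_add, even_two, iff_true]

theorem PWins.not_succ {e : ℕ} {g : ℕ → ℕ} (h : PWins e g) : ¬ PWins (e + 1) g := by
  rintro ⟨m, hm, hf, hmax⟩
  obtain ⟨n, hn, hf', hmax'⟩ := h
  obtain rfl : m = n := le_antisymm (hmax' _ hf) (hmax _ hf')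
  rw [← add_assoc, Nat.even_add_one] at hm
  exact hm hn

theorem PWins.shift_iff {e : ℕ} {g : ℕ → ℕ} (k : ℕ) :
    PWins e (fun i => g (i + k)) ↔ PWins e g := by
  have h (n : ℕ) : (∃ᶠ i in Filter.atTop, g (i + k) = n) ↔ ∃ᶠ i in Filter.atTop, g i = n := by
    conv_rhs => rw [← Filter.map_add_atTop_eq_nat k, Filter.frequently_map]
  simp only [PWins, h]

theorem PWins.add_one_right {e : ℕ} {g : ℕ → ℕ} :
    PWins e (fun i => g i + 1) ↔ PWins (e + 1) g := by
  constructor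
  · rintro ⟨n, hn, hf, hmax⟩
    obtain ⟨i, hi⟩ := hf.exists
    obtain ⟨n, rfl⟩ : ∃ m, n = m + 1 := ⟨g i, hi.symm⟩
    refine ⟨n, by rwa [add_comm e, ← add_assoc], by simpa using hf, fun m hm => ?_⟩
    simpa using hmax (m + 1) (by simpa using hm)
  · rintro ⟨n, hn, hf, hmax⟩
    refine ⟨n + 1, by rwa [add_assoc, add_comm 1], by simpa using hf, fun m hm => ?_⟩
    obtain ⟨i, hi⟩ := hm.exists
    obtain ⟨m, rfl⟩ : ∃ m', m = m' + 1 := ⟨g i, hi.symm⟩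
    simpa using hmax m (by simpa using hm)

theorem PWins.of_eventually_le {e n : ℕ} {g : ℕ → ℕ} (hn : Even (n + e))
    (hf : ∃ᶠ i in Filter.atTop, g i = n) (hle : ∀ᶠ i in Filter.atTop, g i ≤ n) : PWins e g := by
  refine ⟨n, hn, hf, fun m hm => ?_⟩
  obtain ⟨i, hi, hi'⟩ := (hm.and_eventually hle).exists
  omega

theorem frequently_exists_of_finite {ι : Type*} [Finite ι] {p : ι → ℕ → Prop}
    (h : ∃ᶠ i in Filter.atTop, ∃ x, p x i) : ∃ x, ∃ᶠ i in Filter.atTop, p x i := by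
  by_contra hc
  simp only [not_exists, Filter.not_frequently] at hc
  exact h ((Filter.eventually_all.2 hc).mono fun i hi ⟨x, hx⟩ => hi x hx)

theorem eventually_le_of_frequently_le {N n : ℕ} {g : ℕ → ℕ} (hb : ∀ i, g i ≤ N)
    (hmax : ∀ m : ℕ, (∃ᶠ i in Filter.atTop, g i = m) → m ≤ n) :
    ∀ᶠ i in Filter.atTop, g i ≤ n := by
  by_contra hc
  rw [Filter.not_eventually] at hc
  have : ∃ᶠ i in Filter.atTop, ∃ m : Fin (N + 1), n < m ∧ g i = m :=
    hc.mono fun i hi => ⟨⟨g i, Nat.lt_succ_of_le (hb i)⟩, not_le.1 hi, rfl⟩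
  obtain ⟨m, hm⟩ := frequently_exists_of_finite this
  obtain ⟨i, hi⟩ := hm.exists
  have := hmax m (hm.mono fun i hi => hi.2)
  omega

theorem exists_max_frequently {N : ℕ} {g : ℕ → ℕ} (hb : ∀ i, g i ≤ N) :
    ∃ n, (∃ᶠ i in Filter.atTop, g i = n) ∧ ∀ᶠ i in Filter.atTop, g i ≤ n := by
  have h1 : ∃ n, ∃ᶠ i in Filter.atTop, g i = n := by
    have : ∃ᶠ i in Filter.atTop, ∃ m : Fin (N + 1), g i = m :=
      Filter.Frequently.of_forall fun i => ⟨⟨g i, Nat.lt_succ_of_le (hb i)⟩, rfl⟩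
    obtain ⟨m, hm⟩ := frequently_exists_of_finite this
    exact ⟨m, hm⟩
  have hb' : ∀ n, (∃ᶠ i in Filter.atTop, g i = n) → n ≤ N := fun n hn => by
    obtain ⟨i, rfl⟩ := hn.exists
    exact hb i
  have hspec := Nat.findGreatest_spec (P := fun n => ∃ᶠ i in Filter.atTop, g i = n)
    (hb' _ h1.choose_spec) h1.choose_spec
  refine ⟨_, hspec, eventually_le_of_frequently_le hb fun m hm => ?_⟩
  exact Nat.le_findGreatest (hb' m hm) hm

/-! ### Positional determinacy of parity games given by neighbourhood families -/

section Game

variable {Pos : Type}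

/-- Every family `F v` of possible moves is upward closed. -/
def UpClosed (F : Pos → Set (Set Pos)) : Prop :=
  ∀ v X Y, X ⊆ Y → X ∈ F v → Y ∈ F v

/-- The moves of the opponent: sets meeting every set of `F v`. -/
def dualFam (F : Pos → Set (Set Pos)) : Pos → Set (Set Pos) :=
  fun v => {X | Xᶜ ∉ F v}

theorem dualFam_dualFam (F : Pos → Set (Set Pos)) : dualFam (dualFam F) = F := by
  ext v X
  simp [dualFam]

theorem UpClosed.dual {F : Pos → Set (Set Pos)} (hF : UpClosed F) : UpClosed (dualFam F) :=
  fun v _ _ hXY hX hY => hX (hF v _ _ (Set.compl_subset_compl.2 hXY) hY)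

/-- `τ` is a positional strategy staying in `D` which wins every infinite match in `D`. -/
def IsWinStrat (e : ℕ) (F : Pos → Set (Set Pos)) (Ω : Pos → ℕ) (D : Set Pos)
    (τ : Pos → Set Pos) : Prop :=
  (∀ v ∈ D, τ v ∈ F v ∧ τ v ⊆ D) ∧
    ∀ f : ℕ → Pos, f 0 ∈ D → (∀ n, f (n + 1) ∈ τ (f n)) → PWins e (fun i => Ω (f i))

/-- `D` admits a positional winning strategy. -/
def IsRegion (e : ℕ) (F : Pos → Set (Set Pos)) (Ω : Pos → ℕ) (D : Set Pos) : Prop :=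
  ∃ τ, IsWinStrat e F Ω D τ

theorem IsRegion.add_two {e : ℕ} {F : Pos → Set (Set Pos)} {Ω : Pos → ℕ} {D : Set Pos} :
    IsRegion (e + 2) F Ω D ↔ IsRegion e F Ω D := by
  simp only [IsRegion, IsWinStrat, PWins.add_two]

theorem play_mem {D : Set Pos} {τ : Pos → Set Pos} (hτ : ∀ v ∈ D, τ v ⊆ D) {f : ℕ → Pos}
    (h0 : f 0 ∈ D) (hf : ∀ n, f (n + 1) ∈ τ (f n)) (n : ℕ) : f n ∈ D := by
  induction n with
  | zero => exact h0
  | succ n ih => exact hτ _ ih (hf n)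

theorem IsRegion.iUnion {ι : Type*} {e : ℕ} {F : Pos → Set (Set Pos)} {Ω : Pos → ℕ}
    {D : ι → Set Pos} (h : ∀ i, IsRegion e F Ω (D i)) : IsRegion e F Ω (⋃ i, D i) := by
  choose τ hτ using h
  obtain ⟨_, hwo⟩ := exists_wellFoundedLT ι
  have hwf : WellFounded ((· < ·) : ι → ι → Prop) := wellFounded_lt
  have hpick : ∀ v ∈ ⋃ i, D i, ∃ i, v ∈ D i ∧ ∀ j, v ∈ D j → i ≤ j := fun v hv => by
    have hne : {i | v ∈ D i}.Nonempty := Set.mem_iUnion.1 hv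
    exact ⟨hwf.min _ hne, hwf.min_mem _ hne, fun j hj => not_lt.1 (hwf.not_lt_min _ hj)⟩
  by_cases hι : Nonempty ι
  swap
  · rw [not_nonempty_iff] at hι
    exact ⟨fun _ => ∅, by simp, by simp⟩
  choose! pick hp hmin using hpick
  have hsub : ∀ v ∈ ⋃ i, D i, τ (pick v) v ⊆ D (pick v) := fun v hv =>
    ((hτ _).1 v (hp v hv)).2
  have hsub' : ∀ v ∈ ⋃ i, D i, τ (pick v) v ⊆ ⋃ i, D i := fun v hv =>
    (hsub v hv).trans (Set.subset_iUnion _ _)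
  refine ⟨fun v => τ (pick v) v, fun v hv =>
    ⟨((hτ _).1 v (hp v hv)).1, hsub' v hv⟩, fun f h0 hf => ?_⟩
  change ∀ n, f (n + 1) ∈ τ (pick (f n)) (f n) at hf
  have hD := play_mem hsub' h0 hf
  have hanti : Antitone fun n => pick (f n) := antitone_nat_of_succ_le fun n =>
    hmin _ (hD _) _ (hsub _ (hD n) (hf n))
  obtain ⟨N, hN⟩ : ∃ N, ∀ n, pick (f N) ≤ pick (f n) := by
    have hne : (Set.range fun n => pick (f n)).Nonempty := ⟨_, 0, rfl⟩
    obtain ⟨N, hN⟩ := hwf.min_mem _ hne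
    refine ⟨N, fun n => ?_⟩
    simp only at hN
    rw [hN]
    exact not_lt.1 (hwf.not_lt_min (Set.range fun n => pick (f n)) ⟨n, rfl⟩)
  have heq : ∀ n, pick (f (n + N)) = pick (f N) := fun n =>
    le_antisymm (hanti (Nat.le_add_left _ _)) (hN _)
  rw [← PWins.shift_iff N]
  refine (hτ (pick (f N))).2 (fun n => f (n + N)) ?_ fun n => ?_
  · simpa using hp _ (hD N)
  · have := hf (n + N)
    rw [heq n] at this
    simpa only [add_right_comm] using this

theorem IsRegion.extend {e : ℕ} {F : Pos → Set (Set Pos)} {Ω : Pos → ℕ} {W Y : Set Pos}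
    (hW : IsRegion e F Ω W) (τ' : Pos → Set Pos)
    (hτ' : ∀ v ∈ Y, τ' v ∈ F v ∧ τ' v ⊆ W ∪ Y)
    (hwin : ∀ f : ℕ → Pos, (∀ n, f n ∈ Y) → (∀ n, f (n + 1) ∈ τ' (f n)) →
      PWins e (fun i => Ω (f i))) :
    IsRegion e F Ω (W ∪ Y) := by
  obtain ⟨τ, hτ, hτw⟩ := hW
  have hcl : ∀ v ∈ W ∪ Y, (if v ∈ W then τ v else τ' v) ∈ F v ∧
      (if v ∈ W then τ v else τ' v) ⊆ W ∪ Y := by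
    intro v hv
    by_cases hvW : v ∈ W
    · rw [if_pos hvW]
      exact ⟨(hτ v hvW).1, (hτ v hvW).2.trans Set.subset_union_left⟩
    · rw [if_neg hvW]
      exact hτ' v (hv.resolve_left hvW)
  refine ⟨fun v => if v ∈ W then τ v else τ' v, hcl, fun f h0 hf => ?_⟩
  have hD := play_mem (fun v hv => (hcl v hv).2) h0 hf
  change ∀ n, f (n + 1) ∈ if f n ∈ W then τ (f n) else τ' (f n) at hf
  by_cases hex : ∃ N, f N ∈ W
  · obtain ⟨N, hN⟩ := hex
    have hstay : ∀ n, f (n + N) ∈ W := by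
      intro n
      induction n with
      | zero => simpa using hN
      | succ n ih =>
        have := hf (n + N)
        rw [if_pos ih] at this
        rw [add_right_comm]
        exact (hτ _ ih).2 this
    rw [← PWins.shift_iff N]
    refine hτw (fun n => f (n + N)) (by simpa using hN) fun n => ?_
    have := hf (n + N)
    rw [if_pos (hstay n)] at this
    simpa only [add_right_comm] using this
  · simp only [not_exists] at hex
    refine hwin f (fun n => (hD n).resolve_left (hex n)) fun n => ?_
    have := hf n
    rwa [if_neg (hex n)] at this

theorem exists_seq_of_step {α : Type*} {p : α → Prop} {r : α → α → Prop} {a : α} (ha : p a)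
    (h : ∀ x, p x → ∃ y, p y ∧ r x y) :
    ∃ f : ℕ → α, f 0 = a ∧ (∀ n, p (f n)) ∧ ∀ n, r (f n) (f (n + 1)) := by
  choose! g hg hr using h
  have hp : ∀ n, p (g^[n] a) := fun n => by
    induction n with
    | zero => exact ha
    | succ n ih => rw [Function.iterate_succ_apply']; exact hg _ ih
  refine ⟨fun n => g^[n] a, rfl, hp, fun n => ?_⟩
  simp only [Function.iterate_succ_apply']
  exact hr _ (hp n)

theorem IsRegion.disjoint {e : ℕ} {F : Pos → Set (Set Pos)} {Ω : Pos → ℕ} (hF : UpClosed F)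
    {D D' : Set Pos} (hD : IsRegion e F Ω D) (hD' : IsRegion (e + 1) (dualFam F) Ω D') :
    Disjoint D D' := by
  obtain ⟨τ, hτ, hw⟩ := hD
  obtain ⟨τ', hτ', hw'⟩ := hD'
  rw [Set.disjoint_left]
  intro v hv hv'
  obtain ⟨f, h0, hp, hr⟩ := exists_seq_of_step (p := fun v => v ∈ D ∧ v ∈ D')
    (r := fun v w => w ∈ τ v ∧ w ∈ τ' v) (a := v) ⟨hv, hv'⟩ fun v ⟨hv, hv'⟩ => by
      by_contra hc
      refine (hτ' v hv').1 (hF v _ _ (fun w hw hw' => ?_) (hτ v hv).1)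
      exact hc ⟨w, ⟨(hτ v hv).2 hw, (hτ' v hv').2 hw'⟩, hw, hw'⟩
  exact (hw f (hp 0).1 fun n => (hr n).1).not_succ (hw' f (hp 0).2 fun n => (hr n).2)

theorem determined_step {Ω : Pos → ℕ} {n e : ℕ} {F : Pos → Set (Set Pos)} (hne : Even (n + e))
    (hF : UpClosed F) (hb : ∀ v, Ω v < n + 1 ∨ F v = Set.univ ∨ F v = ∅)
    (ih : ∀ F : Pos → Set (Set Pos), UpClosed F →
      (∀ v, Ω v < n ∨ F v = Set.univ ∨ F v = ∅) →
      ∃ D, IsRegion e F Ω D ∧ IsRegion (e + 1) (dualFam F) Ω Dᶜ) :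
    ∃ D, IsRegion e F Ω D ∧ IsRegion (e + 1) (dualFam F) Ω Dᶜ := by
  let T : Set Pos := {v | Ω v = n ∧ F v ≠ Set.univ ∧ F v ≠ ∅}
  let W : Set Pos := ⋃ D : {D : Set Pos // IsRegion (e + 1) (dualFam F) Ω D}, D.1
  have hW : IsRegion (e + 1) (dualFam F) Ω W := IsRegion.iUnion fun D => D.2
  have hWmax : ∀ D, IsRegion (e + 1) (dualFam F) Ω D → D ⊆ W :=
    fun D hD => Set.subset_iUnion (fun D : {D // IsRegion (e + 1) (dualFam F) Ω D} => D.1) ⟨D, hD⟩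
  let F' : Pos → Set (Set Pos) := fun v => if v ∈ T then (if v ∈ W then ∅ else Set.univ) else F v
  have hF'T : ∀ v, v ∉ T → F' v = F v := fun v hv => if_neg hv
  have hF'TW : ∀ v ∈ T, v ∈ W → F' v = ∅ := fun v hv hw => by simp only [F', if_pos hv, if_pos hw]
  have hF'TnW : ∀ v ∈ T, v ∉ W → F' v = Set.univ := fun v hv hw => by
    simp only [F', if_pos hv, if_neg hw]
  have hF' : UpClosed F' := by
    intro v X Y hXY hX
    by_cases hv : v ∈ T
    · by_cases hw : v ∈ W
      · rw [hF'TW v hv hw] at hX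
        exact hX.elim
      · rw [hF'TnW v hv hw]
        trivial
    · rw [hF'T v hv] at hX ⊢
      exact hF v X Y hXY hX
  obtain ⟨D, hD, hDc⟩ := ih F' hF' fun v => by
    by_cases hv : v ∈ T
    · by_cases hw : v ∈ W
      · exact .inr (.inr (hF'TW v hv hw))
      · exact .inr (.inl (hF'TnW v hv hw))
    · rw [hF'T v hv]
      by_cases h : F v = Set.univ ∨ F v = ∅
      · exact .inr h
      · rw [not_or] at h
        have h1 := (hb v).resolve_right (not_or.2 h)
        have h2 : Ω v ≠ n := fun h' => hv ⟨h', h⟩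
        left; omega
  have hDcW : Dᶜ ⊆ W := by
    obtain ⟨τ', hτ', hw'⟩ := hDc
    have hext : IsRegion (e + 1) (dualFam F) Ω (W ∪ Dᶜ \ W) := by
      refine hW.extend τ' ?_ fun f hf hp => hw' f (hf 0).1 hp
      rintro v ⟨hvD, hvW⟩
      have hvT : v ∉ T := fun hvT => by
        have := (hτ' v hvD).1
        rw [dualFam, hF'TnW v hvT hvW] at this
        exact this trivial
      refine ⟨?_, (hτ' v hvD).2.trans ?_⟩
      · have := (hτ' v hvD).1
        rwa [dualFam, hF'T v hvT] at this
      · rw [Set.union_sdiff_self]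
        exact Set.subset_union_right
    have := hWmax _ hext
    rw [Set.union_sdiff_self] at this
    exact Set.subset_union_right.trans this
  have hdisj : Disjoint D W := by
    refine hD.disjoint hF' ?_
    obtain ⟨τ, hτ, hw⟩ := hW
    refine ⟨fun v => if v ∈ T then ∅ else τ v, fun v hv => ?_, fun f h0 hf => ?_⟩
    · by_cases hvT : v ∈ T
      · simp [dualFam, hvT, hF'TW v hvT hv]
      · simp only [if_neg hvT]
        refine ⟨?_, (hτ v hv).2⟩
        have := (hτ v hv).1
        rwa [dualFam, hF'T v hvT]
    · refine hw f h0 fun n => ?_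
      have := hf n
      dsimp only at this
      split_ifs at this with h
      · exact this.elim
      · exact this
  have hDW : Dᶜ = W := Set.Subset.antisymm hDcW (Set.subset_compl_iff_disjoint_left.2 hdisj)
  refine ⟨D, ?_, by rwa [hDW]⟩
  have hTD : ∀ v ∈ D, v ∈ T → D ∈ F v := by
    intro v hv hvT
    by_contra hcon
    have hvW : v ∉ W := Set.disjoint_left.1 hdisj hv
    have hext : IsRegion (e + 1) (dualFam F) Ω (W ∪ {v}) := by
      refine hW.extend (fun _ => W) ?_ fun f hf hp => ?_
      · rintro _ rfl
        refine ⟨?_, Set.subset_union_left⟩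
        rw [← hDW]
        simpa [dualFam] using hcon
      · have h1 : f 1 = v := hf 1
        exact (hvW (h1 ▸ hp 0)).elim
    exact hvW (hWmax _ hext (.inr rfl))
  obtain ⟨τ, hτ, hw⟩ := hD
  let τs : Pos → Set Pos := fun v => if F v = Set.univ then ∅ else if v ∈ T then D else τ v
  have hcl : ∀ v ∈ D, τs v ∈ F v ∧ τs v ⊆ D := by
    intro v hv
    by_cases h1 : F v = Set.univ
    · simp [τs, h1]
    by_cases h2 : v ∈ T
    · simp only [τs, if_neg h1, if_pos h2]
      exact ⟨hTD v hv h2, subset_rfl⟩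
    · simp only [τs, if_neg h1, if_neg h2]
      have := hτ v hv
      rwa [hF'T v h2] at this
  refine ⟨τs, hcl, fun f h0 hf => ?_⟩
  have hfD := play_mem (fun v hv => (hcl v hv).2) h0 hf
  have hnu : ∀ i, F (f i) ≠ Set.univ := fun i h => by
    have := hf i
    simp [τs, h] at this
  have hlt : ∀ i, Ω (f i) ≤ n := fun i => by
    rcases hb (f i) with h | h | h
    · omega
    · exact (hnu i h).elim
    · have := (hcl _ (hfD i)).1
      rw [h] at this
      exact this.elim
  by_cases hfr : ∃ᶠ i in Filter.atTop, f i ∈ T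
  · exact .of_eventually_le hne (hfr.mono fun i hi => hi.1) (.of_forall hlt)
  · rw [Filter.not_frequently, Filter.eventually_atTop] at hfr
    obtain ⟨N, hN⟩ := hfr
    rw [← PWins.shift_iff N]
    refine hw (fun i => f (i + N)) (hfD _) fun i => ?_
    have := hf (i + N)
    simp only [τs, if_neg (hnu _), if_neg (hN (i + N) (Nat.le_add_left _ _))] at this
    simpa only [add_right_comm] using this

theorem determined {Ω : Pos → ℕ} (n e : ℕ) {F : Pos → Set (Set Pos)}
    (hF : UpClosed F) (hb : ∀ v, Ω v < n ∨ F v = Set.univ ∨ F v = ∅) :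
    ∃ D, IsRegion e F Ω D ∧ IsRegion (e + 1) (dualFam F) Ω Dᶜ := by
  induction n generalizing e F with
  | zero =>
    refine ⟨{v | F v = Set.univ}, ⟨fun _ => ∅, ?_, fun f _ hf => (hf 0).elim⟩,
      ⟨fun _ => ∅, ?_, fun f _ hf => (hf 0).elim⟩⟩
    · intro v hv
      change F v = Set.univ at hv
      simp [hv]
    · intro v hv
      have := ((hb v).resolve_left (Nat.not_lt_zero _)).resolve_left hv
      simp [dualFam, this]
  | succ n ih =>
    by_cases hne : Even (n + e)
    · exact determined_step hne hF hb fun F hF hb => ih e hF hb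
    · have hne' : Even (n + (e + 1)) := by rwa [← add_assoc, Nat.even_add_one]
      obtain ⟨D, h1, h2⟩ := determined_step (F := dualFam F) hne' hF.dual (fun v => by
        rcases hb v with h | h | h
        · exact .inl h
        · right; right; ext X; simp [dualFam, h]
        · right; left; ext X; simp [dualFam, h]) fun F hF hb => ih (e + 1) hF hb
      rw [dualFam_dualFam] at h2
      exact ⟨Dᶜ, IsRegion.add_two.1 h2, by rwa [compl_compl]⟩

end Game

/-! ### Determinization of word automata through a finite monoid -/

section Determinize

variable {N : Type} [Monoid N]

/-- The product of the letters of `x` at the positions `i, …, k - 1`. -/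
def seg (x : ℕ → N) (i k : ℕ) : N := ((List.range' i (k - i)).map x).prod

theorem seg_self (x : ℕ → N) (i : ℕ) : seg x i i = 1 := by simp [seg]

theorem seg_succ (x : ℕ → N) {i k : ℕ} (h : i ≤ k) : seg x i (k + 1) = seg x i k * x k := by
  obtain ⟨d, rfl⟩ := Nat.exists_eq_add_of_le h
  have h1 : i + d + 1 - i = d + 1 := by omega
  have h2 : i + d - i = d := by omega
  simp [seg, h1, h2, List.range'_concat]

theorem seg_mul (x : ℕ → N) {i j k : ℕ} (h : i ≤ j) (h' : j ≤ k) :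
    seg x i k = seg x i j * seg x j k := by
  induction k, h' using Nat.le_induction with
  | base => simp [seg_self]
  | succ k hk ih => rw [seg_succ x (h.trans hk), seg_succ x hk, ih, mul_assoc]

/-- Position `j` is still the first position of its merging class at time `k`. -/
def ActPos (x : ℕ → N) (k j : ℕ) : Prop := j ≤ k ∧ ∀ i < j, seg x i k ≠ seg x j k

theorem ActPos.inj {x : ℕ → N} {k i j : ℕ} (hi : ActPos x k i) (hj : ActPos x k j)
    (h : seg x i k = seg x j k) : i = j := by
  rcases lt_trichotomy i j with hlt | rfl | hlt
  · exact (hj.2 i hlt h).elim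
  · rfl
  · exact (hi.2 j hlt h.symm).elim

theorem ActPos.anti {x : ℕ → N} {k k' j : ℕ} (h : ActPos x k' j) (hj : j ≤ k) (hk : k ≤ k') :
    ActPos x k j := by
  refine ⟨hj, fun i hi heq => h.2 i hi ?_⟩
  rw [seg_mul x (hi.le.trans hj) hk, seg_mul x hj hk, heq]

theorem actPos_zero (x : ℕ → N) (k : ℕ) : ActPos x k 0 :=
  ⟨Nat.zero_le _, fun _ h => (Nat.not_lt_zero _ h).elim⟩

theorem exists_actPos (x : ℕ → N) {k j : ℕ} (h : j ≤ k) :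
    ∃ i ≤ j, ActPos x k i ∧ seg x i k = seg x j k := by
  have hex : ∃ i, seg x i k = seg x j k := ⟨j, rfl⟩
  have hle : Nat.find hex ≤ j := Nat.find_min' hex rfl
  refine ⟨Nat.find hex, hle, ⟨hle.trans h, fun i hi heq => ?_⟩, Nat.find_spec hex⟩
  exact Nat.find_min hex hi (heq.trans (Nat.find_spec hex))

theorem actPos_self {x : ℕ → N} (hone : ∀ k u, u * x k ≠ 1) (k : ℕ) : ActPos x k k := by
  refine ⟨le_rfl, fun i hi => ?_⟩
  obtain ⟨k, rfl⟩ := Nat.exists_eq_succ_of_ne_zero (Nat.ne_zero_of_lt hi)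
  rw [seg_self, seg_succ x (Nat.lt_succ_iff.1 hi)]
  exact hone k _

/-- The number of active positions before `j`. -/
noncomputable def idxPos (x : ℕ → N) (k j : ℕ) : ℕ := {i | i < j ∧ ActPos x k i}.ncard

theorem finite_lt_act (x : ℕ → N) (k j : ℕ) : {i | i < j ∧ ActPos x k i}.Finite :=
  (Set.finite_lt_nat j).subset fun _ h => h.1

theorem idxPos_mono (x : ℕ → N) {k i j : ℕ} (h : i ≤ j) : idxPos x k i ≤ idxPos x k j :=
  Set.ncard_le_ncard (fun _ h' => ⟨h'.1.trans_le h, h'.2⟩) (finite_lt_act x k j)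

theorem idxPos_lt (x : ℕ → N) {k i j : ℕ} (hi : ActPos x k i) (h : i < j) :
    idxPos x k i < idxPos x k j := by
  refine Set.ncard_lt_ncard ⟨fun _ h' => ⟨h'.1.trans h, h'.2⟩, fun hsub => ?_⟩
    (finite_lt_act x k j)
  exact lt_irrefl _ (hsub (a := i) ⟨h, hi⟩).1

theorem idxPos_le_card [Finite N] (x : ℕ → N) (k j : ℕ) : idxPos x k j ≤ Nat.card N := by
  rw [← Set.ncard_univ]
  refine Set.ncard_le_ncard_of_injOn (fun i => seg x i k) (fun _ _ => trivial) ?_ Set.finite_univ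
  exact fun i hi j hj h => hi.2.inj hj.2 h

/-- The priority of a step, where the events `D t` (the active position of index `t` dies) and
`G t` (the active position of index `t` is confirmed) are more important for smaller `t`. -/
noncomputable def eventPrio (K : ℕ) (D G : ℕ → Prop) : ℕ :=
  sSup {n | n = 1 ∨ (∃ t, D t ∧ n = 2 * (K - t) + 3) ∨ ∃ t, G t ∧ n = 2 * (K - t) + 2}

theorem eventPrio_bdd (K : ℕ) (D G : ℕ → Prop) :
    ∀ n ∈ {n | n = 1 ∨ (∃ t, D t ∧ n = 2 * (K - t) + 3) ∨ ∃ t, G t ∧ n = 2 * (K - t) + 2},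
      n ≤ 2 * K + 3 := by
  rintro n (rfl | ⟨t, -, rfl⟩ | ⟨t, -, rfl⟩) <;> omega

theorem eventPrio_spec (K : ℕ) (D G : ℕ → Prop) :
    eventPrio K D G = 1 ∨ (∃ t, D t ∧ eventPrio K D G = 2 * (K - t) + 3) ∨
      ∃ t, G t ∧ eventPrio K D G = 2 * (K - t) + 2 :=
  Nat.sSup_mem (s := {n | n = 1 ∨ (∃ t, D t ∧ n = 2 * (K - t) + 3) ∨
    ∃ t, G t ∧ n = 2 * (K - t) + 2}) ⟨1, .inl rfl⟩ ⟨_, eventPrio_bdd K D G⟩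

theorem eventPrio_le (K : ℕ) (D G : ℕ → Prop) : eventPrio K D G ≤ 2 * K + 3 :=
  csSup_le ⟨1, .inl rfl⟩ (eventPrio_bdd K D G)

theorem le_eventPrio_of_dies {K : ℕ} {D G : ℕ → Prop} {t : ℕ} (h : D t) :
    2 * (K - t) + 3 ≤ eventPrio K D G :=
  le_csSup ⟨_, eventPrio_bdd K D G⟩ (.inr (.inl ⟨t, h, rfl⟩))

theorem le_eventPrio_of_good {K : ℕ} {D G : ℕ → Prop} {t : ℕ} (h : G t) :
    2 * (K - t) + 2 ≤ eventPrio K D G :=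
  le_csSup ⟨_, eventPrio_bdd K D G⟩ (.inr (.inr ⟨t, h, rfl⟩))

/-- The active position of index `t` dies at time `k`. -/
def DiesPos (x : ℕ → N) (k t : ℕ) : Prop :=
  ∃ j, ActPos x k j ∧ ¬ ActPos x (k + 1) j ∧ idxPos x k j = t

/-- The active position `i` absorbs a later one at time `k`, with accepting values. -/
def GoodPos (acc : N → N → Prop) (x : ℕ → N) (k t : ℕ) : Prop :=
  ∃ i j, ActPos x (k + 1) i ∧ i < j ∧ ActPos x k j ∧ seg x i (k + 1) = seg x j (k + 1) ∧
    acc (seg x 0 i) (seg x i j) ∧ idxPos x k i = t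

theorem exists_factorization {x : ℕ → N} {p : ℕ} {e : N}
    (h : {j | p < j ∧ seg x p j = e ∧ ∃ k ≥ j, seg x p k = seg x j k}.Infinite) :
    ∃ c : ℕ → ℕ, StrictMono c ∧ c 0 = p ∧ ∀ l l', l < l' → seg x (c l) (c l') = e := by
  set S := {j | p < j ∧ seg x p j = e ∧ ∃ k ≥ j, seg x p k = seg x j k} with hS
  have hm : ∀ j ∈ S, ∃ k ≥ j, seg x p k = seg x j k := fun j hj => hj.2.2
  choose! mt hmt hseg using hm
  obtain ⟨j0, hj0⟩ := h.nonempty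
  obtain ⟨f, -, hfS, hf⟩ := exists_seq_of_step (p := (· ∈ S)) (r := fun j j' => mt j < j')
    hj0 fun j _ => by
      obtain ⟨j', hj', hlt⟩ := h.exists_gt (mt j)
      exact ⟨j', hj', hlt⟩
  have hmono : StrictMono f := strictMono_nat_of_lt_succ fun n =>
    (hmt _ (hfS n)).trans_lt (hf n)
  refine ⟨fun l => Nat.casesOn l p f, strictMono_nat_of_lt_succ fun n => ?_, rfl, ?_⟩
  · cases n with
    | zero => exact (hfS 0).1
    | succ n => exact hmono n.lt_succ_self
  · rintro (_ | l) (_ | l') hl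
    · exact (lt_irrefl _ hl).elim
    · exact (hfS l').2.1
    · exact (Nat.not_lt_zero _ hl).elim
    · have hl' : l < l' := Nat.lt_of_succ_lt_succ hl
      have hle : mt (f l) ≤ f l' := (hf l).le.trans (hmono.monotone hl')
      change seg x (f l) (f l') = e
      rw [seg_mul x (hmt _ (hfS l)) hle, ← hseg _ (hfS l),
        ← seg_mul x ((hfS l).1.le.trans (hmt _ (hfS l))) hle]
      exact (hfS l').2.1

theorem idx_stable {x : ℕ → N} {K0 p t : ℕ} (hp : ActPos x K0 p) (hidx : idxPos x K0 p = t)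
    (hd : ∀ k ≥ K0, ∀ t' ≤ t, ¬ DiesPos x k t') :
    ∀ k ≥ K0, ActPos x k p ∧ idxPos x k p = t := by
  intro k hk
  induction k, hk using Nat.le_induction with
  | base => exact ⟨hp, hidx⟩
  | succ k hk ih =>
    have hsurv : ∀ i ≤ p, ActPos x k i → ActPos x (k + 1) i := fun i hi ha => by
      by_contra hc
      exact hd k hk _ (ih.2 ▸ idxPos_mono x hi) ⟨i, ha, hc, rfl⟩
    refine ⟨hsurv p le_rfl ih.1, ?_⟩
    rw [← ih.2, idxPos, idxPos]
    congr 1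
    ext i
    exact ⟨fun h => ⟨h.1, h.2.anti (h.1.le.trans ih.1.1) k.le_succ⟩,
      fun h => ⟨h.1, hsurv i h.1.le h.2⟩⟩

variable [Finite N]

theorem infinite_absorbed {x : ℕ → N} {p : ℕ} {q : N → Prop}
    (h : ∃ᶠ k in Filter.atTop, ∃ j, p < j ∧ ActPos x k j ∧ seg x p (k + 1) = seg x j (k + 1) ∧
      q (seg x p j)) :
    ∃ e, q e ∧ {j | p < j ∧ seg x p j = e ∧ ∃ k ≥ j, seg x p k = seg x j k}.Infinite := by
  have h' : ∃ᶠ k in Filter.atTop, ∃ e : N, ∃ j, p < j ∧ ActPos x k j ∧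
      seg x p (k + 1) = seg x j (k + 1) ∧ q e ∧ seg x p j = e :=
    h.mono fun k ⟨j, h1, h2, h3, h4⟩ => ⟨_, j, h1, h2, h3, h4, rfl⟩
  obtain ⟨e, he⟩ := frequently_exists_of_finite h'
  obtain ⟨_, j, -, -, -, hq, -⟩ := he.exists
  refine ⟨e, hq, fun hfin => ?_⟩
  have hinf : {k | ∃ j, p < j ∧ ActPos x k j ∧ seg x p (k + 1) = seg x j (k + 1) ∧ q e ∧
      seg x p j = e}.Infinite := Nat.frequently_atTop_iff_infinite.1 he
  choose! g hg using fun k (hk : k ∈ {k | ∃ j, p < j ∧ ActPos x k j ∧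
    seg x p (k + 1) = seg x j (k + 1) ∧ q e ∧ seg x p j = e}) => hk
  refine hinf (Set.Finite.of_finite_image (f := g) (hfin.subset ?_) ?_)
  · rintro _ ⟨k, hk, rfl⟩
    obtain ⟨h1, h2, h3, -, h5⟩ := hg k hk
    exact ⟨h1, h5, k + 1, h2.1.trans k.le_succ, h3⟩
  · have key : ∀ k k', k < k' → g k = g k' → ∀ (_ : p < g k) (_ : ActPos x k (g k))
        (_ : seg x p (k + 1) = seg x (g k) (k + 1)) (_ : ActPos x k' (g k')), False := by
      intro k k' hlt heq h1 h2 h3 h4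
      rw [← heq] at h4
      exact (h4.anti (h2.1.trans k.le_succ) hlt).2 p h1 h3
    intro k hk k' hk' heq
    rcases lt_trichotomy k k' with hlt | h | hlt
    · exact (key _ _ hlt heq (hg k hk).1 (hg k hk).2.1 (hg k hk).2.2.1 (hg k' hk').2.1).elim
    · exact h
    · exact (key _ _ hlt heq.symm (hg k' hk').1 (hg k' hk').2.1 (hg k' hk').2.2.1
        (hg k hk).2.1).elim

/-- The priority of the step at time `k`. -/
noncomputable def segPrio (acc : N → N → Prop) (x : ℕ → N) (k : ℕ) : ℕ :=
  eventPrio (Nat.card N) (DiesPos x k) (GoodPos acc x k)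

theorem GoodPos.le_card {acc : N → N → Prop} {x : ℕ → N} {k t : ℕ} (h : GoodPos acc x k t) :
    t ≤ Nat.card N := by
  obtain ⟨i, j, -, -, -, -, -, rfl⟩ := h
  exact idxPos_le_card x k i

theorem DiesPos.le_card {x : ℕ → N} {k t : ℕ} (h : DiesPos x k t) : t ≤ Nat.card N := by
  obtain ⟨j, -, -, rfl⟩ := h
  exact idxPos_le_card x k j

theorem exists_factorization_of_wins {acc : N → N → Prop} {x : ℕ → N}
    (h : PWins 0 (segPrio acc x)) :
    ∃ c : ℕ → ℕ, ∃ e, StrictMono c ∧ acc (seg x 0 (c 0)) e ∧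
      ∀ l l', l < l' → seg x (c l) (c l') = e := by
  obtain ⟨n, hn, hf, hmax⟩ := h
  have hle := eventually_le_of_frequently_le (fun k => eventPrio_le _ _ _) hmax
  have hgood : ∀ k, segPrio acc x k = n → ∃ t, GoodPos acc x k t ∧ n = 2 * (Nat.card N - t) + 2 := by
    intro k hk
    rw [add_zero] at hn
    rcases eventPrio_spec (Nat.card N) (DiesPos x k) (GoodPos acc x k) with h | ⟨t, -, h⟩ | ⟨t, ht, h⟩
    · rw [← hk, segPrio, h] at hn
      exact absurd hn (by decide)
    · rw [← hk, segPrio, h] at hn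
      exact absurd hn (by simp [parity_simps])
    · exact ⟨t, ht, hk.symm.trans h⟩
  obtain ⟨k1, hk1⟩ := hf.exists
  obtain ⟨t, htg, hnt⟩ := hgood k1 hk1
  have ht := htg.le_card
  have hgood' : ∀ k, segPrio acc x k = n → GoodPos acc x k t := by
    intro k hk
    obtain ⟨t', htg', hnt'⟩ := hgood k hk
    have := htg'.le_card
    obtain rfl : t' = t := by omega
    exact htg'
  obtain ⟨K1, hK1⟩ := Filter.eventually_atTop.1 hle
  obtain ⟨K0, hK0, hK0n⟩ := Filter.frequently_atTop.1 hf K1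
  obtain ⟨p, pj, hp, hpj, hj, -, -, hidx⟩ := hgood' K0 hK0n
  have hst := idx_stable (hp.anti (hpj.le.trans hj.1) (Nat.le_succ _)) hidx fun k hk t' ht' hd => by
    have h1 : segPrio acc x k ≤ n := hK1 k (hK0.trans hk)
    have h2 : 2 * (Nat.card N - t') + 3 ≤ segPrio acc x k := le_eventPrio_of_dies hd
    have := hd.le_card
    omega
  have habs : ∃ᶠ k in Filter.atTop, ∃ j, p < j ∧ ActPos x k j ∧
      seg x p (k + 1) = seg x j (k + 1) ∧ acc (seg x 0 p) (seg x p j) := by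
    refine (hf.and_eventually (Filter.eventually_ge_atTop K0)).mono fun k ⟨hk, hkK⟩ => ?_
    obtain ⟨i, j, hi, hij, hj, heq, hacc, hidx⟩ := hgood' k hk
    obtain ⟨hpa, hpi⟩ := hst k hkK
    have hia := hi.anti (hij.le.trans hj.1) k.le_succ
    obtain rfl : i = p := by
      rcases lt_trichotomy i p with hlt | h | hlt
      · have := idxPos_lt x hia hlt
        omega
      · exact h
      · have := idxPos_lt x hpa hlt
        omega
    exact ⟨j, hij, hj, heq, hacc⟩
  obtain ⟨e, he, hinf⟩ := infinite_absorbed (q := fun e => acc (seg x 0 p) e) habs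
  obtain ⟨c, hc, hc0, hce⟩ := exists_factorization hinf
  exact ⟨c, e, hc, hc0 ▸ he, hce⟩

theorem finite_permanent (x : ℕ → N) : {j | ∀ k ≥ j, ActPos x k j}.Finite := by
  by_contra hinf
  obtain ⟨s, hs, hcard⟩ := Set.Infinite.exists_subset_card_eq hinf (Nat.card N + 1)
  set B := s.sup id
  have hB : ∀ j ∈ s, ActPos x B j := fun j hj => hs hj B (Finset.le_sup (f := id) hj)
  have : s.card ≤ Nat.card N := by
    rw [← Set.ncard_univ, ← Set.ncard_coe_finset]
    refine Set.ncard_le_ncard_of_injOn (fun i => seg x i B) (fun _ _ => trivial) ?_ Set.finite_univ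
    exact fun i hi j hj h => (hB i hi).inj (hB j hj) h
  omega

theorem wins_of_factorizations {acc : N → N → Prop} {x : ℕ → N} (hone : ∀ k u, u * x k ≠ 1)
    (hacc : ∀ c : ℕ → ℕ, ∀ e, StrictMono c → (∀ l l', l < l' → seg x (c l) (c l') = e) →
      acc (seg x 0 (c 0)) e) :
    PWins 0 (segPrio acc x) := by
  set P := {j | ∀ k ≥ j, ActPos x k j} with hP
  have hPfin : P.Finite := finite_permanent x
  obtain ⟨B, hB⟩ := hPfin.bddAbove
  -- after `K0`, the active positions up to `B` are the permanent ones
  obtain ⟨K0, hK0B, hK0⟩ : ∃ K0, B < K0 ∧ ∀ k ≥ K0, ∀ j ≤ B, ActPos x k j → j ∈ P := by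
    have : ∀ᶠ k in Filter.atTop, ∀ j ∈ Set.Iic B, ActPos x k j → j ∈ P := by
      refine (Filter.eventually_all_finite (Set.finite_Iic B)).2 fun j _ => ?_
      by_cases hj : j ∈ P
      · exact .of_forall fun _ _ => hj
      · have : ∃ k ≥ j, ¬ ActPos x k j := by
          by_contra hc
          push Not at hc
          exact hj hc
        obtain ⟨k, hkj, hk⟩ := this
        filter_upwards [Filter.eventually_ge_atTop k] with k' hk' hact
        exact (hk (hact.anti hkj hk')).elim
    obtain ⟨K, hK⟩ := Filter.eventually_atTop.1 this
    exact ⟨max K (B + 1), by omega, fun k hk j hj => hK k (by omega) j hj⟩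
  have habs : ∃ᶠ k in Filter.atTop, ∃ p : P, ∃ j, p.1 < j ∧ ActPos x k j ∧
      seg x p (k + 1) = seg x j (k + 1) ∧ True := by
    rw [Filter.frequently_atTop]
    intro K1
    set K := max K0 K1
    have hKP : K ∉ P := fun h => by
      have := hB h
      omega
    have hex : ∃ j, ActPos x K j ∧ j ∉ P := ⟨K, actPos_self hone K, hKP⟩
    obtain ⟨hjK, hjP⟩ := Nat.find_spec hex
    set j := Nat.find hex
    have hdie : ∃ k, K ≤ k ∧ ActPos x k j ∧ ¬ ActPos x (k + 1) j := by
      by_contra hc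
      push Not at hc
      refine hjP fun k hk => ?_
      rcases le_total K k with h | h
      · induction k, h using Nat.le_induction with
        | base => exact hjK
        | succ k hk' ih => exact hc k hk' (ih (hjK.1.trans hk'))
      · exact hjK.anti hk h
    obtain ⟨k, hKk, hk, hk'⟩ := hdie
    obtain ⟨i, hij, hi, heq⟩ := exists_actPos x (hk.1.trans k.le_succ)
    have hne : i ≠ j := fun h => hk' (h ▸ hi)
    have hij : i < j := lt_of_le_of_ne hij hne
    have hiP : i ∈ P := by
      by_contra hc
      exact Nat.find_min hex hij ⟨hi.anti (hij.le.trans hjK.1) (hKk.trans k.le_succ), hc⟩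
    exact ⟨k, by omega, ⟨i, hiP⟩, j, hij, hk, heq, trivial⟩
  have : Finite P := hPfin
  obtain ⟨⟨p, hp⟩, habs⟩ := frequently_exists_of_finite habs
  have hidx : ∀ k ≥ K0, idxPos x k p = {i | i < p ∧ i ∈ P}.ncard := by
    intro k hk
    rw [idxPos]
    congr 1
    ext i
    refine ⟨fun h => ⟨h.1, hK0 k hk i (h.1.le.trans (hB hp)) h.2⟩, fun h => ⟨h.1, h.2 k ?_⟩⟩
    have := hB h.2
    omega
  set t := {i | i < p ∧ i ∈ P}.ncard
  have hdie : ∀ k ≥ K0, ∀ t', DiesPos x k t' → t < t' := by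
    rintro k hk t' ⟨j, hj, hj', rfl⟩
    rw [← hidx k hk]
    refine idxPos_lt x (hp k ?_) ?_
    · have := hB hp
      omega
    · by_contra hle
      have hjP := hK0 k hk j ((not_lt.1 hle).trans (hB hp)) hj
      exact hj' (hjP _ (hj.1.trans k.le_succ))
  have hgood : ∃ᶠ k in Filter.atTop, GoodPos acc x k t := by
    have hacc' : ∃ᶠ k in Filter.atTop, ∃ j, p < j ∧ ActPos x k j ∧
        seg x p (k + 1) = seg x j (k + 1) ∧ acc (seg x 0 p) (seg x p j) := by
      by_contra hc
      obtain ⟨e, he, hinf⟩ := infinite_absorbed (q := fun e => ¬ acc (seg x 0 p) e) (by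
        refine (habs.and_eventually (Filter.not_frequently.1 hc)).mono ?_
        rintro k ⟨⟨j, h1, h2, h3, -⟩, h⟩
        exact ⟨j, h1, h2, h3, fun h4 => h ⟨j, h1, h2, h3, h4⟩⟩)
      obtain ⟨c, hc, hc0, hce⟩ := exists_factorization hinf
      have hc0 : c 0 = p := hc0
      exact he (hc0 ▸ hacc c e hc hce)
    refine (hacc'.and_eventually (Filter.eventually_ge_atTop K0)).mono ?_
    rintro k ⟨⟨j, h1, h2, h3, h4⟩, hk⟩
    exact ⟨p, j, hp _ (h1.le.trans (h2.1.trans k.le_succ)), h1, h2, h3, h4, hidx k hk⟩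
  obtain ⟨n, hf, hle⟩ := exists_max_frequently
    (g := segPrio acc x) (fun k => eventPrio_le _ _ _)
  refine .of_eventually_le ?_ hf hle
  obtain ⟨k1, hk1, hk1'⟩ := (hgood.and_eventually hle).exists
  have h1 : 2 * (Nat.card N - t) + 2 ≤ segPrio acc x k1 := le_eventPrio_of_good hk1
  obtain ⟨k, hk, hkK⟩ := (hf.and_eventually (Filter.eventually_ge_atTop K0)).exists
  rcases eventPrio_spec (Nat.card N) (DiesPos x k) (GoodPos acc x k) with h | ⟨t', ht', h⟩ | ⟨t', -, h⟩
  · rw [segPrio] at hk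
    omega
  · have := hdie k hkK t' ht'
    have := ht'.le_card
    rw [segPrio] at hk
    omega
  · rw [segPrio] at hk
    rw [← hk, h]
    simp [parity_simps]

theorem segPrio_wins_iff {acc : N → N → Prop} {x : ℕ → N} (hone : ∀ k u, u * x k ≠ 1) {L : Prop}
    (hL : ∀ c : ℕ → ℕ, ∀ e, StrictMono c → (∀ l l', l < l' → seg x (c l) (c l') = e) →
      (L ↔ acc (seg x 0 (c 0)) e)) :
    PWins 0 (segPrio acc x) ↔ L := by
  constructor
  · intro h
    obtain ⟨c, e, hc, hacc, hce⟩ := exists_factorization_of_wins h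
    exact (hL c e hc hce).2 hacc
  · exact fun h => wins_of_factorizations hone fun c e hc hce => (hL c e hc hce).1 h

end Determinize

section SegState

variable {N : Type} [Monoid N]

/-- The finite information about the prefix of length `k` that determines the step priorities:
the values of the active positions, their order, the products between active positions, and
the product of the whole prefix. -/
@[ext]
structure SegState (N : Type) where
  act : N → Prop
  lt : N → N → Prop
  dist : N → N → N → Prop
  tot : N

instance [Finite N] : Finite (SegState N) :=
  Finite.of_injective (fun q => (q.act, q.lt, q.dist, q.tot)) fun _ _ h => by
    simp only [Prod.mk.injEq] at h
    exact SegState.ext h.1 h.2.1 h.2.2.1 h.2.2.2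

/-- The state reached after reading the first `k` letters of `x`. -/
def segState (x : ℕ → N) (k : ℕ) : SegState N where
  act u := ∃ i, ActPos x k i ∧ seg x i k = u
  lt u v := ∃ i j, ActPos x k i ∧ ActPos x k j ∧ i < j ∧ seg x i k = u ∧ seg x j k = v
  dist u v w := ∃ i j, ActPos x k i ∧ ActPos x k j ∧ i ≤ j ∧ seg x i k = u ∧ seg x j k = v ∧
    seg x i j = w
  tot := seg x 0 k

/-- The active position with value `u` survives when reading `a`. -/
def SegState.Surv (q : SegState N) (a u : N) : Prop :=
  q.act u ∧ ∀ v, q.lt v u → v * a ≠ u * a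

/-- The transition function on states. -/
def SegState.next (q : SegState N) (a : N) : SegState N where
  act m := m = 1 ∨ ∃ u, q.Surv a u ∧ u * a = m
  lt m m' := ∃ u, q.Surv a u ∧ u * a = m ∧ (m' = 1 ∨ ∃ u', q.Surv a u' ∧ u' * a = m' ∧ q.lt u u')
  dist m m' w := (m' = 1 ∧ w = m ∧ (m = 1 ∨ ∃ u, q.Surv a u ∧ u * a = m)) ∨
    ∃ u u', q.Surv a u ∧ u * a = m ∧ q.Surv a u' ∧ u' * a = m' ∧ q.dist u u' w
  tot := q.tot * a

/-- The priority of the transition from `q` under `a`. -/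
noncomputable def SegState.prio (acc : N → N → Prop) (q : SegState N) (a : N) : ℕ :=
  eventPrio (Nat.card N)
    (fun t => ∃ u, q.act u ∧ ¬ q.Surv a u ∧ {v | q.lt v u}.ncard = t)
    (fun t => ∃ u v w w', q.Surv a u ∧ q.lt u v ∧ u * a = v * a ∧ q.dist q.tot u w ∧
      q.dist u v w' ∧ acc w w' ∧ {v | q.lt v u}.ncard = t)

theorem SegState.prio_le (acc : N → N → Prop) (q : SegState N) (a : N) :
    q.prio acc a ≤ 2 * Nat.card N + 3 :=
  eventPrio_le _ _ _

theorem surv_iff {x : ℕ → N} {k j : ℕ} (hj : ActPos x k j) :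
    (segState x k).Surv (x k) (seg x j k) ↔ ActPos x (k + 1) j := by
  constructor
  · rintro ⟨-, h⟩
    refine ⟨hj.1.trans k.le_succ, fun i hi heq => ?_⟩
    obtain ⟨i', hi', ha, he⟩ := exists_actPos x (hi.le.trans hj.1)
    refine h _ ⟨i', j, ha, hj, hi'.trans_lt hi, rfl, rfl⟩ ?_
    rwa [he, ← seg_succ x hj.1, ← seg_succ x (hi.le.trans hj.1)]
  · rintro h
    refine ⟨⟨j, hj, rfl⟩, ?_⟩
    rintro _ ⟨i, j', hi, hj', hlt, rfl, heq⟩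
    obtain rfl := hj'.inj hj heq
    rw [← seg_succ x hj.1, ← seg_succ x hi.1]
    exact h.2 i hlt

theorem exists_surv {x : ℕ → N} {k : ℕ} {u : N} (h : (segState x k).Surv (x k) u) :
    ∃ j, ActPos x k j ∧ ActPos x (k + 1) j ∧ seg x j k = u ∧ seg x j (k + 1) = u * x k := by
  obtain ⟨j, hj, rfl⟩ := h.1
  exact ⟨j, hj, (surv_iff hj).1 h, rfl, seg_succ x hj.1⟩

theorem ActPos.eq_or_surv {x : ℕ → N} {k j : ℕ} (h : ActPos x (k + 1) j) :
    j = k + 1 ∨ j ≤ k ∧ ActPos x k j ∧ (segState x k).Surv (x k) (seg x j k) ∧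
      seg x j k * x k = seg x j (k + 1) := by
  rcases Nat.le_succ_iff.1 h.1 with hj | hj
  · have := h.anti hj k.le_succ
    exact .inr ⟨hj, this, (surv_iff this).2 h, (seg_succ x hj).symm⟩
  · exact .inl hj

theorem segState_succ {x : ℕ → N} (hone : ∀ k u, u * x k ≠ 1) (k : ℕ) :
    segState x (k + 1) = (segState x k).next (x k) := by
  have hk : ActPos x (k + 1) (k + 1) := actPos_self hone _
  ext
  · rename_i m
    constructor
    · rintro ⟨j, hj, rfl⟩
      rcases hj.eq_or_surv with rfl | ⟨-, -, h, h'⟩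
      · exact .inl (seg_self _ _)
      · exact .inr ⟨_, h, h'⟩
    · rintro (rfl | ⟨u, hu, rfl⟩)
      · exact ⟨_, hk, seg_self _ _⟩
      · obtain ⟨j, -, hj, -, h⟩ := exists_surv hu
        exact ⟨j, hj, h⟩
  · rename_i m m'
    constructor
    · rintro ⟨i, j, hi, hj, hij, rfl, rfl⟩
      have hik : i ≤ k := Nat.lt_succ_iff.1 (hij.trans_le hj.1)
      rcases hi.eq_or_surv with rfl | ⟨-, hi', h, h'⟩
      · omega
      refine ⟨_, h, h', ?_⟩
      rcases hj.eq_or_surv with rfl | ⟨-, hj', g, g'⟩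
      · exact .inl (seg_self _ _)
      · exact .inr ⟨_, g, g', i, j, hi', hj', hij, rfl, rfl⟩
    · rintro ⟨u, hu, rfl, rfl | ⟨v, hv, rfl, i, j, hi, hj, hij, rfl, rfl⟩⟩
      · obtain ⟨j, hj', hj, -, h⟩ := exists_surv hu
        exact ⟨j, _, hj, hk, Nat.lt_succ_of_le hj'.1, h, seg_self _ _⟩
      · exact ⟨i, j, (surv_iff hi).1 hu, (surv_iff hj).1 hv, hij, seg_succ x hi.1,
          seg_succ x hj.1⟩
  · rename_i m m' w
    constructor
    · rintro ⟨i, j, hi, hj, hij, rfl, rfl, rfl⟩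
      rcases hj.eq_or_surv with rfl | ⟨hjk, hj', g, g'⟩
      · refine .inl ⟨seg_self _ _, rfl, ?_⟩
        rcases hi.eq_or_surv with rfl | ⟨-, -, h, h'⟩
        · exact .inl (seg_self _ _)
        · exact .inr ⟨_, h, h'⟩
      · rcases hi.eq_or_surv with rfl | ⟨-, hi', h, h'⟩
        · omega
        · exact .inr ⟨_, _, h, h', g, g', i, j, hi', hj', hij, rfl, rfl, rfl⟩
    · rintro (⟨rfl, rfl, rfl | ⟨u, hu, rfl⟩⟩ | ⟨u, v, hu, rfl, hv, rfl, i, j, hi, hj, hij, rfl, rfl, rfl⟩)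
      · exact ⟨_, _, hk, hk, le_rfl, seg_self _ _, seg_self _ _, seg_self _ _⟩
      · obtain ⟨j, hj', hj, -, h⟩ := exists_surv hu
        exact ⟨j, _, hj, hk, hj.1, h, seg_self _ _, h⟩
      · exact ⟨i, j, (surv_iff hi).1 hu, (surv_iff hj).1 hv, hij, seg_succ x hi.1,
          seg_succ x hj.1, rfl⟩
  · exact seg_succ x (Nat.zero_le k)

theorem segState_ncard {x : ℕ → N} {k j : ℕ} (hj : ActPos x k j) :
    {v | (segState x k).lt v (seg x j k)}.ncard = idxPos x k j := by
  have : {v | (segState x k).lt v (seg x j k)} =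
      (fun i => seg x i k) '' {i | i < j ∧ ActPos x k i} := by
    ext v
    constructor
    · rintro ⟨i, j', hi, hj', hlt, rfl, heq⟩
      obtain rfl := hj'.inj hj heq
      exact ⟨i, ⟨hlt, hi⟩, rfl⟩
    · rintro ⟨i, ⟨hlt, hi⟩, rfl⟩
      exact ⟨i, j, hi, hj, hlt, rfl, rfl⟩
  rw [this, Set.InjOn.ncard_image fun i hi i' hi' h => hi.2.inj hi'.2 h, idxPos]

theorem segState_prio (acc : N → N → Prop) (x : ℕ → N) (k : ℕ) :
    (segState x k).prio acc (x k) = segPrio acc x k := by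
  rw [SegState.prio, segPrio]
  congr 1
  · ext t
    constructor
    · rintro ⟨_, ⟨j, hj, rfl⟩, hs, rfl⟩
      exact ⟨j, hj, fun h => hs ((surv_iff hj).2 h), (segState_ncard hj).symm⟩
    · rintro ⟨j, hj, hs, rfl⟩
      exact ⟨_, ⟨j, hj, rfl⟩, fun h => hs ((surv_iff hj).1 h), segState_ncard hj⟩
  · ext t
    constructor
    · rintro ⟨_, _, _, _, hs, ⟨i, j, hi, hj, hij, rfl, rfl⟩, heq,
        ⟨i0, i1, h0, h1, -, h01, h11, rfl⟩, ⟨i2, j2, h2, h3, -, h22, h33, rfl⟩, hacc, rfl⟩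
      obtain rfl := h0.inj (actPos_zero x k) h01
      obtain rfl := h1.inj hi h11
      obtain rfl := h2.inj hi h22
      obtain rfl := h3.inj hj h33
      rw [← seg_succ x hi.1, ← seg_succ x hj.1] at heq
      exact ⟨_, _, (surv_iff hi).1 hs, hij, hj, heq, hacc, (segState_ncard hi).symm⟩
    · rintro ⟨i, j, hi', hij, hj, heq, hacc, rfl⟩
      have hi := hi'.anti (hij.le.trans hj.1) k.le_succ
      rw [seg_succ x hi.1, seg_succ x hj.1] at heq
      exact ⟨_, _, _, _, (surv_iff hi).2 hi', ⟨i, j, hi, hj, hij, rfl, rfl⟩, heq,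
        ⟨0, i, actPos_zero x k, hi, Nat.zero_le _, rfl, rfl, rfl⟩,
        ⟨i, j, hi, hj, hij.le, rfl, rfl, rfl⟩, hacc, segState_ncard hi⟩

theorem segState_zero_eq (x y : ℕ → N) : segState x 0 = segState y 0 := by
  have hz (z : ℕ → N) (i : ℕ) : ActPos z 0 i ↔ i = 0 :=
    ⟨fun h => Nat.le_zero.1 h.1, fun h => h ▸ actPos_zero z 0⟩
  simp [segState, hz, seg_self]

/-- A finite deterministic automaton computes `segPrio`. -/
theorem exists_automaton_segPrio [Finite N] (acc : N → N → Prop) :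
    ∃ (Q : Type) (_ : Finite Q) (q₀ : Q) (δ : Q → N → Q) (Ω : Q → ℕ),
      ∀ x : ℕ → N, (∀ k u, u * x k ≠ 1) → ∀ ρ : ℕ → Q, ρ 0 = q₀ →
        (∀ k, ρ (k + 1) = δ (ρ k) (x k)) → ∀ k, Ω (ρ (k + 1)) = segPrio acc x k := by
  refine ⟨SegState N × Fin (2 * Nat.card N + 4), inferInstance, (segState (fun _ => 1) 0, 0),
    fun q a => (q.1.next a, ⟨q.1.prio acc a, Nat.lt_succ_of_le (q.1.prio_le acc a)⟩),
    fun q => q.2, fun x hone ρ h0 hs k => ?_⟩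
  have hρ : ∀ k, (ρ k).1 = segState x k := by
    intro k
    induction k with
    | zero => rw [h0]; exact segState_zero_eq _ _
    | succ k ih =>
      rw [hs, segState_succ hone, ← ih]
  rw [hs, ← segState_prio, ← hρ]

end SegState

theorem exists_block {c : ℕ → ℕ} (hc : StrictMono c) (h0 : c 0 = 0) (k : ℕ) :
    ∃ l, c l ≤ k ∧ k < c (l + 1) := by
  have hex : ∃ l, k < c l := ⟨k + 1, (Nat.lt_succ_self k).trans_le (hc.id_le _)⟩
  obtain ⟨l, hl⟩ : ∃ l, Nat.find hex = l + 1 := by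
    refine Nat.exists_eq_succ_of_ne_zero fun h => ?_
    have := Nat.find_spec hex
    rw [h, h0] at this
    exact Nat.not_lt_zero _ this
  exact ⟨l, not_lt.1 (Nat.find_min hex (by omega)), hl ▸ Nat.find_spec hex⟩

theorem exists_glue {A : Type} {c : ℕ → ℕ} (hc : StrictMono c) (h0 : c 0 = 0) (τ : ℕ → ℕ → A)
    (hτ : ∀ l, τ l (c (l + 1)) = τ (l + 1) (c (l + 1))) :
    ∃ t : ℕ → A, ∀ l j, c l ≤ j → j ≤ c (l + 1) → t j = τ l j := by
  choose b hb hb' using exists_block hc h0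
  have huniq : ∀ l j, c l ≤ j → j < c (l + 1) → b j = l := fun l j h1 h2 => by
    have h3 := hc.lt_iff_lt.1 (h1.trans_lt (hb' j))
    have h4 := hc.lt_iff_lt.1 ((hb j).trans_lt h2)
    omega
  refine ⟨fun j => τ (b j) j, fun l j h1 h2 => ?_⟩
  rcases h2.lt_or_eq with h2 | rfl
  · simp only [huniq l j h1 h2]
  · simp only [huniq (l + 1) _ le_rfl (hc (l + 1).lt_succ_self), hτ]

section Traces

variable {A : Type} {n : ℕ}

/-- The monoid in which runs of traces are evaluated; the second component makes sure that no
letter has a right inverse. -/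
abbrev TraceMon (A : Type) (n : ℕ) : Type := Function.End (Set (A × Fin (n + 1))) × ZMod 2

/-- The letter of a relation: its action on sets of pairs of a state and a maximal priority. -/
def traceLetter (Ω : A → Fin (n + 1)) (r : A → A → Prop) : TraceMon A n :=
  (fun Y => {p | ∃ b, r p.1 b ∧ (b, max p.2 (Ω p.1)) ∈ Y}, 0)

theorem mem_seg_iff (Ω : A → Fin (n + 1)) (r : ℕ → A → A → Prop) {i k : ℕ} (h : i ≤ k) (a : A)
    (m : Fin (n + 1)) (Y : Set (A × Fin (n + 1))) :
    (a, m) ∈ (seg (fun j => traceLetter Ω (r j)) i k).1 Y ↔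
      ∃ t : ℕ → A, t i = a ∧ (∀ j, i ≤ j → j < k → r j (t j) (t (j + 1))) ∧
        (t k, max m ((Finset.Ico i k).sup fun j => Ω (t j))) ∈ Y := by
  induction k, h using Nat.le_induction generalizing Y with
  | base =>
    rw [seg_self]
    change (a, m) ∈ Y ↔ _
    constructor
    · exact fun h => ⟨fun _ => a, rfl, fun j h1 h2 => (by omega), by simpa using h⟩
    · rintro ⟨t, rfl, -, h⟩
      simpa using h
  | succ k hk ih =>
    rw [seg_succ _ hk]
    refine (ih ((traceLetter Ω (r k)).1 Y)).trans ⟨?_, ?_⟩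
    · rintro ⟨t, rfl, hr, b, hb, hY⟩
      have heq : ∀ j ≤ k, Function.update t (k + 1) b j = t j := fun j hj =>
        Function.update_of_ne (by omega) _ _
      refine ⟨Function.update t (k + 1) b, heq i hk, fun j h1 h2 => ?_, ?_⟩
      · rcases (Nat.lt_succ_iff.1 h2).lt_or_eq with h3 | rfl
        · rw [heq j h3.le, heq (j + 1) h3]
          exact hr j h1 h3
        · rw [heq j le_rfl, Function.update_self]
          exact hb
      · rw [Function.update_self, Finset.sup_congr rfl fun j hj => by
          rw [heq j (Nat.lt_succ_iff.1 (Finset.mem_Ico.1 hj).2)]]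
        rw [← Finset.insert_Ico_right_eq_Ico_add_one hk, Finset.sup_insert]
        simpa [sup_comm, sup_assoc, sup_left_comm] using hY
    · rintro ⟨t, rfl, hr, hY⟩
      refine ⟨t, rfl, fun j h1 h2 => hr j h1 (h2.trans k.lt_succ_self), t (k + 1),
        hr k hk k.lt_succ_self, ?_⟩
      rw [← Finset.insert_Ico_right_eq_Ico_add_one hk, Finset.sup_insert] at hY
      simpa [sup_comm, sup_assoc, sup_left_comm] using hY

/-- All traces through idempotent blocks are accepting. -/
def TraceAcc (aI : A) (s e : TraceMon A n) : Prop :=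
  ∀ a m m', (aI, 0) ∈ (s * e).1 {(a, m)} → (a, 0) ∈ e.1 {(a, m')} → Even (m' : ℕ)

theorem traces_win_iff [Finite A] (Ω : A → Fin (n + 1)) (aI : A) (r : ℕ → A → A → Prop)
    {c : ℕ → ℕ} {e : TraceMon A n} (hc : StrictMono c)
    (he : ∀ l l', l < l' → seg (fun j => traceLetter Ω (r j)) (c l) (c l') = e) :
    (∀ t : ℕ → A, t 0 = aI → (∀ i, r i (t i) (t (i + 1))) → PWins 0 fun i => Ω (t i)) ↔
      TraceAcc aI (seg (fun j => traceLetter Ω (r j)) 0 (c 0)) e := by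
  have hse : ∀ l, 1 ≤ l → seg (fun j => traceLetter Ω (r j)) 0 (c 0) * e =
      seg (fun j => traceLetter Ω (r j)) 0 (c l) := fun l hl => by
    rw [seg_mul _ (Nat.zero_le (c 0)) (hc.monotone (Nat.zero_le l)), he 0 l hl]
  constructor
  · intro h a m m' h1 h2
    rw [hse 1 le_rfl, mem_seg_iff Ω r (Nat.zero_le _)] at h1
    obtain ⟨t0, ht0, hr0, hm0⟩ := h1
    have h2 (l : ℕ) : ∃ t : ℕ → A, t (c l) = a ∧
        (∀ j, c l ≤ j → j < c (l + 1) → r j (t j) (t (j + 1))) ∧ t (c (l + 1)) = a ∧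
        ((Finset.Ico (c l) (c (l + 1))).sup fun j => Ω (t j)) = m' := by
      rw [← he l (l + 1) l.lt_succ_self, mem_seg_iff Ω r (hc l.lt_succ_self).le] at h2
      obtain ⟨t, h1, h2, h3⟩ := h2
      simp only [Set.mem_singleton_iff, Prod.mk.injEq] at h3
      exact ⟨t, h1, h2, h3.1, by simpa using h3.2⟩
    choose τ hτ1 hτr hτ2 hτm using h2
    have hd : StrictMono fun l => if l = 0 then 0 else c l := by
      refine strictMono_nat_of_lt_succ fun l => ?_
      have := hc l.lt_succ_self
      by_cases hl : l = 0
      · simp only [hl, if_true]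
        exact (Nat.zero_le _).trans_lt (hl ▸ this)
      · simpa [hl] using this
    obtain ⟨t, ht⟩ := exists_glue hd rfl (fun l => if l = 0 then t0 else τ l) fun l => by
      by_cases hl : l = 0
      · simp only [Set.mem_singleton_iff, Prod.mk.injEq] at hm0
        simp [hl, hm0.1, hτ1]
      · simp [hl, hτ2, hτ1]
    have ht1 : ∀ l, 1 ≤ l → ∀ j, c l ≤ j → j ≤ c (l + 1) → t j = τ l j := fun l hl j h1 h2 => by
      have hl : l ≠ 0 := by omega
      simpa [hl] using ht l j (by simpa [hl] using h1) (by simpa using h2)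
    have ht0' : ∀ j ≤ c 1, t j = t0 j := fun j h => ht 0 j (Nat.zero_le _) h
    obtain ⟨N, hN, hf, hmax⟩ := h t ((ht0' 0 (Nat.zero_le _)).trans ht0) fun i => by
      obtain ⟨l, h1, h2⟩ := exists_block hd rfl i
      by_cases hl : l = 0
      · simp only [hl, zero_add, one_ne_zero, if_false] at h2
        rw [ht0' _ h2.le, ht0' _ h2]
        exact hr0 i (Nat.zero_le _) h2
      · simp only [hl, if_false, Nat.succ_ne_zero] at h1 h2
        rw [ht1 l (by omega) i h1 h2.le, ht1 l (by omega) (i + 1) (by omega) h2]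
        exact hτr l i h1 h2
    have hsup : ∀ l, 1 ≤ l → ((Finset.Ico (c l) (c (l + 1))).sup fun j => Ω (t j)) = m' := by
      intro l hl
      rw [← hτm l]
      refine Finset.sup_congr rfl fun j hj => ?_
      rw [Finset.mem_Ico] at hj
      rw [ht1 l hl j hj.1 hj.2.le]
    have hle : ∀ i ≥ c 1, Ω (t i) ≤ m' := by
      intro i hi
      obtain ⟨l, h1, h2⟩ := exists_block hd rfl i
      by_cases hl : l = 0
      · simp only [hl, zero_add, one_ne_zero, if_false] at h2
        omega
      · simp only [hl, if_false, Nat.succ_ne_zero] at h1 h2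
        rw [← hsup l (by omega)]
        exact Finset.le_sup (f := fun j => Ω (t j)) (Finset.mem_Ico.2 ⟨h1, h2⟩)
    have hfreq : ∃ᶠ i in Filter.atTop, (Ω (t i) : ℕ) = m' := by
      refine Filter.frequently_atTop.2 fun K => ?_
      have hne : (Finset.Ico (c (K + 1)) (c (K + 1 + 1))).Nonempty :=
        Finset.nonempty_Ico.2 (hc (K + 1).lt_succ_self)
      obtain ⟨i, hi, him⟩ := Finset.exists_mem_eq_sup _ hne fun j => Ω (t j)
      rw [hsup (K + 1) (by omega)] at him
      rw [Finset.mem_Ico] at hi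
      have := hc.id_le (K + 1)
      exact ⟨i, by simp only [id] at this; omega, by rw [him]⟩
    obtain ⟨i, hi, hi'⟩ := (hf.and_eventually (Filter.eventually_ge_atTop (c 1))).exists
    have : N = m' := le_antisymm (hi ▸ hle i hi') (hmax _ hfreq)
    rwa [← this]
  · intro hacc t ht0 hr
    obtain ⟨N, hf, hle⟩ := exists_max_frequently (g := fun i => (Ω (t i) : ℕ))
      (fun i => Nat.lt_succ_iff.1 (Ω (t i)).2)
    refine .of_eventually_le ?_ hf hle
    obtain ⟨a, ha⟩ := frequently_exists_of_finite (p := fun a l => t (c l) = a)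
      (Filter.Frequently.of_forall fun l => ⟨_, rfl⟩)
    obtain ⟨K, hK⟩ := Filter.eventually_atTop.1 hle
    obtain ⟨l1, hl1, hl1a⟩ := Filter.frequently_atTop.1 ha (K + 1)
    obtain ⟨i, hi, hiN⟩ := Filter.frequently_atTop.1 hf (c l1)
    obtain ⟨l2, hl2, hl2a⟩ := Filter.frequently_atTop.1 ha (i + 1)
    have hid1 : l1 ≤ c l1 := hc.id_le l1
    have hid2 : l2 ≤ c l2 := hc.id_le l2
    have hlt : l1 < l2 := by omega
    have hsup : (((Finset.Ico (c l1) (c l2)).sup fun j => Ω (t j)) : Fin (n + 1)) = Ω (t i) := by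
      refine le_antisymm (Finset.sup_le fun j hj => ?_)
        (Finset.le_sup (f := fun j => Ω (t j)) (Finset.mem_Ico.2 ⟨hi, by omega⟩))
      rw [Finset.mem_Ico] at hj
      exact Fin.le_def.2 ((hK j (by omega)).trans hiN.ge)
    have := hacc a _ (Ω (t i)) (by
      rw [hse l1 (by omega), mem_seg_iff Ω r (Nat.zero_le _)]
      exact ⟨t, ht0, fun j _ _ => hr j, by rw [hl1a]; rfl⟩) (by
      rw [← he l1 l2 hlt, mem_seg_iff Ω r (hc hlt).le]
      refine ⟨t, hl1a, fun j _ _ => hr j, ?_⟩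
      rw [hl2a, hsup]
      simp)
    rwa [hiN] at this

/-- Deterministic automata recognize the sequences of relations all of whose traces from `aI`
satisfy the parity condition. -/
theorem exists_trace_automaton (A : Type) [Finite A] (Ω : A → ℕ) (aI : A) :
    ∃ (Q : Type) (_ : Finite Q) (q₀ : Q) (δ : Q → (A → A → Prop) → Q) (Ω' : Q → ℕ),
      ∀ (r : ℕ → A → A → Prop) (ρ : ℕ → Q), ρ 0 = q₀ → (∀ k, ρ (k + 1) = δ (ρ k) (r k)) →
        (PWins 0 (fun i => Ω' (ρ i)) ↔
          ∀ t : ℕ → A, t 0 = aI → (∀ i, r i (t i) (t (i + 1))) → PWins 0 fun i => Ω (t i)) := by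
  obtain ⟨n, hn⟩ : ∃ n, ∀ a, Ω a ≤ n := by
    obtain ⟨n, hn⟩ := (Set.finite_range Ω).bddAbove
    exact ⟨n, fun a => hn ⟨a, rfl⟩⟩
  set Ωf : A → Fin (n + 1) := fun a => ⟨Ω a, Nat.lt_succ_of_le (hn a)⟩
  have : Finite (TraceMon A n) := inferInstanceAs (Finite ((_ → _) × ZMod 2))
  obtain ⟨Q, hQ, q₀, δ, Ω', h⟩ := exists_automaton_segPrio (TraceAcc (A := A) (n := n) aI)
  refine ⟨Q, hQ, q₀, fun q r => δ q (traceLetter Ωf r), Ω', fun r ρ h0 hs => ?_⟩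
  have hone : ∀ k (u : TraceMon A n), u * traceLetter Ωf (r k) ≠ 1 := fun k u h => by
    have := congrArg Prod.snd h
    simp [traceLetter] at this
  rw [← PWins.shift_iff 1]
  simp only [h _ hone ρ h0 hs]
  exact segPrio_wins_iff hone fun c e hc he => traces_win_iff Ωf aI r hc he

end Traces

/-! ### One-step definability -/

section Definability

variable {T : SetFunctor} {F : LiftingFamily T}

theorem SOForm.sat_congr {W X : Type} {α : T.obj X} (φ : SOForm F W) {V V' : W → Set X}
    (h : ∀ w ∈ φ.fv, V w = V' w) : φ.sat X α V ↔ φ.sat X α V' := by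
  induction φ generalizing V V' with
  | subset a b => simp only [SOForm.sat, h a (.inl rfl), h b (.inr rfl)]
  | lift i v =>
    have : (fun k => V (v k)) = fun k => V' (v k) := funext fun k => h _ ⟨k, rfl⟩
    simp only [SOForm.sat, this]
  | neg φ ih => exact not_congr (ih h)
  | or φ ψ ih ih' =>
    exact or_congr (ih fun w hw => h w (.inl hw)) (ih' fun w hw => h w (.inr hw))
  | ex w φ ih =>
    refine exists_congr fun Z => ih fun w' hw' => ?_
    unfold updW
    split_ifs with hw
    · rfl
    · exact h w' ⟨hw', hw⟩

/-- Renaming of variables. -/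
def SOForm.ren {W W' : Type} (f : W → W') : SOForm F W → SOForm F W'
  | .subset a b => .subset (f a) (f b)
  | .lift i v => .lift i fun k => f (v k)
  | .neg φ => .neg (φ.ren f)
  | .or φ ψ => .or (φ.ren f) (ψ.ren f)
  | .ex w φ => .ex (f w) (φ.ren f)

theorem SOForm.sat_ren {W W' X : Type} {α : T.obj X} {f : W → W'} (hf : f.Injective)
    (φ : SOForm F W) (V : W' → Set X) :
    (φ.ren f).sat X α V ↔ φ.sat X α fun w => V (f w) := by
  induction φ generalizing V with
  | subset a b => rfl
  | lift i v => rfl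
  | neg φ ih => exact not_congr (ih V)
  | or φ ψ ih ih' => exact or_congr (ih V) (ih' V)
  | ex w φ ih =>
    refine exists_congr fun Z => (ih _).trans ?_
    have : (fun w' => updW V (f w) Z (f w')) = updW (fun w => V (f w)) w Z := by
      funext w'
      simp only [updW, hf.eq_iff]
    rw [this]

theorem SOForm.fv_ren {W W' : Type} {f : W → W'} (hf : f.Injective) (φ : SOForm F W) :
    (φ.ren f).fv = f '' φ.fv := by
  induction φ with
  | subset a b => exact (Set.image_pair f a b).symm
  | lift i v => exact Set.range_comp f v
  | neg φ ih => exact ih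
  | or φ ψ ih ih' => simp only [SOForm.ren, SOForm.fv, ih, ih', Set.image_union]
  | ex w φ ih => simp only [SOForm.ren, SOForm.fv, ih, Set.image_sdiff hf, Set.image_singleton]

/-- Quantification over a list of variables. -/
def SOForm.exs {W : Type} (l : List W) (φ : SOForm F W) : SOForm F W := l.foldr .ex φ

theorem SOForm.sat_exs {W X : Type} {α : T.obj X} (l : List W) (φ : SOForm F W) (V : W → Set X) :
    (SOForm.exs l φ).sat X α V ↔ ∃ V', (∀ w ∉ l, V' w = V w) ∧ φ.sat X α V' := by
  induction l generalizing V with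
  | nil =>
    refine ⟨fun h => ⟨V, fun _ _ => rfl, h⟩, ?_⟩
    rintro ⟨V', h, hs⟩
    rwa [show V' = V from funext fun w => h w List.not_mem_nil] at hs
  | cons w l ih =>
    constructor
    · rintro ⟨Z, h⟩
      obtain ⟨V', h, hs⟩ := (ih _).1 h
      refine ⟨V', fun w' hw' => ?_, hs⟩
      rw [List.mem_cons, not_or] at hw'
      rw [h w' hw'.2, updW, if_neg hw'.1]
    · rintro ⟨V', h, hs⟩
      refine ⟨V' w, (ih _).2 ⟨V', fun w' hw' => ?_, hs⟩⟩
      unfold updW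
      split_ifs with heq
      · rw [heq]
      · exact h w' (by simp [heq, hw'])

theorem SOForm.fv_exs {W : Type} (l : List W) (φ : SOForm F W) :
    (SOForm.exs l φ).fv = φ.fv \ {w | w ∈ l} := by
  induction l with
  | nil => simp [SOForm.exs]
  | cons w l ih =>
    change (SOForm.exs l φ).fv \ {w} = _
    rw [ih, Set.sdiff_sdiff]
    congr 1
    ext w'
    simp

/-- Properties of one-step models over `A`. -/
abbrev OneStep (T : SetFunctor) (A : Type) : Type 1 := (X : Type) → T.obj X → (A → Set X) → Prop

/-- Definability of a property of one-step models by a sentence. -/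
def Dfn (F : LiftingFamily T) {A : Type} (Q : OneStep T A) : Prop :=
  ∃ φ : SOForm F (A ⊕ ℕ), IsSentence φ ∧ ∀ X α V, φ.sat0 X α V ↔ Q X α V

namespace Dfn

variable {A B : Type} {Q Q' : OneStep T A}

theorem congr (h : Dfn F Q) (hQ : ∀ X α V, Q X α V ↔ Q' X α V) : Dfn F Q' := by
  obtain ⟨φ, hφ, h⟩ := h
  exact ⟨φ, hφ, fun X α V => (h X α V).trans (hQ X α V)⟩

theorem not (h : Dfn F Q) : Dfn F fun X α V => ¬ Q X α V := by
  obtain ⟨φ, hφ, h⟩ := h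
  exact ⟨.neg φ, hφ, fun X α V => not_congr (h X α V)⟩

theorem or (h : Dfn F Q) (h' : Dfn F Q') : Dfn F fun X α V => Q X α V ∨ Q' X α V := by
  obtain ⟨φ, hφ, h⟩ := h
  obtain ⟨φ', hφ', h'⟩ := h'
  exact ⟨.or φ φ', fun w hw => hw.elim (hφ w) (hφ' w),
    fun X α V => or_congr (h X α V) (h' X α V)⟩

theorem and (h : Dfn F Q) (h' : Dfn F Q') : Dfn F fun X α V => Q X α V ∧ Q' X α V :=
  (h.not.or h'.not).not.congr fun X α V => by tauto

theorem imp (h : Dfn F Q) (h' : Dfn F Q') : Dfn F fun X α V => Q X α V → Q' X α V :=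
  (h.not.or h').congr fun X α V => by tauto

theorem true : Dfn F fun X (_ : T.obj X) (_ : A → Set X) => True := by
  refine ⟨.ex (.inr 0) (.subset (.inr 0) (.inr 0)), ?_, fun X α V => ?_⟩
  · rintro w ⟨h | h, hw⟩ <;> exact (hw h).elim
  · exact ⟨fun _ => trivial, fun _ => ⟨∅, subset_rfl⟩⟩

theorem const (p : Prop) : Dfn F fun X (_ : T.obj X) (_ : A → Set X) => p := by
  by_cases hp : p
  · exact true.congr fun _ _ _ => by simp [hp]
  · exact true.not.congr fun _ _ _ => by simp [hp]

theorem subset (a b : A) : Dfn F fun X (_ : T.obj X) (V : A → Set X) => V a ⊆ V b := by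
  refine ⟨.subset (.inl a) (.inl b), ?_, fun X α V => Iff.rfl⟩
  rintro w (rfl | rfl)
  exacts [⟨a, rfl⟩, ⟨b, rfl⟩]

theorem lift (i : F.ι) (v : Fin (F.ar i) → A) :
    Dfn F fun X (α : T.obj X) (V : A → Set X) => α ∈ (F.lf i).app X fun k => V (v k) := by
  refine ⟨.lift i fun k => .inl (v k), ?_, fun X α V => Iff.rfl⟩
  rintro _ ⟨k, rfl⟩
  exact ⟨_, rfl⟩

theorem all {ι : Type} [Finite ι] {Q : ι → OneStep T A} (h : ∀ i, Dfn F (Q i)) :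
    Dfn F fun X α V => ∀ i, Q i X α V := by
  have := Fintype.ofFinite ι
  have key : ∀ s : Finset ι, Dfn F fun X α V => ∀ i ∈ s, Q i X α V := fun s => by
    induction s using Finset.induction_on with
    | empty => exact true.congr fun _ _ _ => by simp
    | insert i s _ ih => exact ((h i).and ih).congr fun _ _ _ => by simp
  exact (key Finset.univ).congr fun _ _ _ => by simp

theorem any {ι : Type} [Finite ι] {Q : ι → OneStep T A} (h : ∀ i, Dfn F (Q i)) :
    Dfn F fun X α V => ∃ i, Q i X α V :=
  (all fun i => (h i).not).not.congr fun _ _ _ => by simp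

theorem ex [Finite B] {Q : OneStep T (A ⊕ B)} (h : Dfn F Q) :
    Dfn F fun X α V => ∃ V' : B → Set X, Q X α (Sum.elim V V') := by
  obtain ⟨φ, hφ, h⟩ := h
  obtain ⟨enc, henc⟩ := Countable.exists_injective_nat B
  have := Fintype.ofFinite B
  set f : (A ⊕ B) ⊕ ℕ → A ⊕ ℕ :=
    Sum.elim (Sum.elim .inl fun b => .inr (2 * enc b)) fun n => .inr (2 * n + 1) with hfdef
  have hf : f.Injective := by
    rintro ((a | b) | n) ((a' | b') | n') heq <;> simp [hfdef] at heq
    · rw [heq]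
    · rw [henc heq]
    · omega
    · omega
    · rw [heq]
  set l : List (A ⊕ ℕ) := Finset.univ.toList.map fun b => Sum.inr (2 * enc b) with hl
  have hb : ∀ b, f (.inl (.inr b)) ∈ l := fun b => by
    rw [hl, List.mem_map]
    exact ⟨b, by simp, rfl⟩
  have ha : ∀ a, (Sum.inl a : A ⊕ ℕ) ∉ l := fun a => by simp [hl]
  refine ⟨.exs l (φ.ren f), fun w hw => ?_, fun X α V => ?_⟩
  · rw [SOForm.fv_exs, SOForm.fv_ren hf] at hw
    obtain ⟨⟨w, hw, rfl⟩, hl⟩ := hw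
    obtain ⟨a | b, rfl⟩ := hφ w hw
    · exact ⟨a, rfl⟩
    · exact (hl (hb b)).elim
  · rw [SOForm.sat0, SOForm.sat_exs]
    constructor
    · rintro ⟨V', hV, hs⟩
      refine ⟨fun b => V' (f (.inl (.inr b))), (h _ _ _).1 ?_⟩
      rw [SOForm.sat_ren hf] at hs
      refine (SOForm.sat_congr φ fun w hw => ?_).1 hs
      obtain ⟨a | b, rfl⟩ := hφ w hw
      · exact hV _ (ha a)
      · rfl
    · rintro ⟨V', hs⟩
      refine ⟨fun w => {x | (∃ a, w = .inl a ∧ x ∈ V a) ∨ ∃ b, w = f (.inl (.inr b)) ∧ x ∈ V' b},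
        fun w hw => ?_, (SOForm.sat_ren hf _ _).2 ?_⟩
      · obtain a | n := w
        · ext x
          simp [hfdef]
        · ext x
          simp only [reduceCtorEq, false_and, exists_false, false_or, Set.mem_ofPred_eq, Sum.elim_inr,
            Set.mem_empty_iff_false, iff_false, not_exists, not_and]
          intro b hb'
          exact (hw (hb' ▸ hb b)).elim
      · refine (SOForm.sat_congr φ fun w hw => ?_).1 ((h _ _ _).2 hs)
        obtain ⟨a | b, rfl⟩ := hφ w hw
        · ext x
          simp [hfdef]
        · ext x
          simp [hfdef, henc.eq_iff]

theorem comap_injective {Q : OneStep T B} (h : Dfn F Q) {g : B → A} (hg : g.Injective) :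
    Dfn F fun X α V => Q X α fun b => V (g b) := by
  obtain ⟨φ, hφ, h⟩ := h
  have hf : (Sum.map g id : B ⊕ ℕ → A ⊕ ℕ).Injective := hg.sumMap Function.injective_id
  refine ⟨φ.ren (Sum.map g id), fun w hw => ?_, fun X α V => ?_⟩
  · rw [SOForm.fv_ren hf] at hw
    obtain ⟨w, hw, rfl⟩ := hw
    obtain ⟨b, rfl⟩ := hφ w hw
    exact ⟨g b, rfl⟩
  · rw [SOForm.sat0, SOForm.sat_ren hf]
    refine Iff.trans ?_ (h X α fun b => V (g b))
    refine SOForm.sat_congr φ fun w hw => ?_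
    obtain ⟨b, rfl⟩ := hφ w hw
    rfl

theorem all_sets [Finite B] {Q : OneStep T (A ⊕ B)} (h : Dfn F Q) :
    Dfn F fun X α V => ∀ V' : B → Set X, Q X α (Sum.elim V V') :=
  h.not.ex.not.congr fun _ _ _ => by simp

theorem empty (a : A) : Dfn F fun X (_ : T.obj X) (V : A → Set X) => V a = ∅ := by
  refine (all_sets (B := Unit) (subset (.inl a) (.inr ()))).congr fun X α V => ?_
  exact ⟨fun h => Set.subset_empty_iff.1 (h fun _ => ∅), fun h _ => by simp [h]⟩

theorem disjoint (a b : A) :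
    Dfn F fun X (_ : T.obj X) (V : A → Set X) => Disjoint (V a) (V b) := by
  refine (all_sets (B := Unit) ((subset (.inr ()) (.inl a)).imp ((subset (.inr ()) (.inl b)).imp
    (empty (.inr ()))))).congr fun X α V => ?_
  rw [Set.disjoint_iff_inter_eq_empty]
  constructor
  · exact fun h => h (fun _ => V a ∩ V b) Set.inter_subset_left Set.inter_subset_right
  · exact fun h V' h1 h2 => Set.subset_empty_iff.1 (h ▸ Set.subset_inter h1 h2)

theorem pointwise [Finite A] (p : Set A → Prop) :
    Dfn F fun X (_ : T.obj X) (V : A → Set X) => ∀ x, p {a | x ∈ V a} := by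
  have key (c : Set A) : Dfn F fun X (_ : T.obj X) (V : A → Set X) => ∃ x, {a | x ∈ V a} = c := by
    refine (ex (B := Unit) ((empty (.inr ())).not.and (all (ι := A) fun a =>
      ((const (a ∈ c)).imp (subset (.inr ()) (.inl a))).and
        ((const (a ∉ c)).imp (disjoint (.inr ()) (.inl a)))))).congr fun X α V => ?_
    constructor
    · rintro ⟨V', hne, h⟩
      obtain ⟨x, hx⟩ := Set.nonempty_iff_ne_empty.2 hne
      refine ⟨x, Set.ext fun a => ⟨fun hxa => ?_, fun ha => (h a).1 ha hx⟩⟩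
      by_contra ha
      exact Set.disjoint_left.1 ((h a).2 ha) hx hxa
    · rintro ⟨x, rfl⟩
      refine ⟨fun _ => {x}, Set.singleton_ne_empty x, fun a => ⟨?_, ?_⟩⟩
      · exact fun ha => Set.singleton_subset_iff.2 ha
      · exact fun ha => Set.disjoint_singleton_left.2 ha
  refine (all (ι := Set A) fun c => (const (¬ p c)).imp (key c).not).congr fun X α V => ?_
  constructor
  · intro h x
    by_contra hp
    exact h _ hp ⟨x, rfl⟩
  · rintro h _ hp ⟨x, rfl⟩
    exact hp (h x)

end Dfn

end Definability

/-! ### Automata with semantic one-step conditions -/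

section SemanticAutomata

variable {T : SetFunctor} {F : LiftingFamily T}

theorem exists_prefix {α : Type} {r : α → α → Prop} {a b : α} (h : Relation.ReflTransGen r a b)
    {f : ℕ → α} (h0 : f 0 = b) (hs : ∀ n, r (f n) (f (n + 1))) :
    ∃ (g : ℕ → α) (k : ℕ), g 0 = a ∧ (∀ n, r (g n) (g (n + 1))) ∧ ∀ n, g (n + k) = f n := by
  induction h using Relation.ReflTransGen.head_induction_on with
  | refl => exact ⟨f, 0, h0, hs, fun _ => rfl⟩
  | @head a c hac _ ih =>
    obtain ⟨g, k, hg0, hg, hk⟩ := ih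
    refine ⟨fun n => Nat.casesOn n a g, k + 1, rfl, ?_, hk⟩
    rintro (_ | n)
    · change r a (g 0)
      rwa [hg0]
    · exact hg n

/-- An automaton whose one-step conditions are definable properties of one-step models. -/
structure SAut (T : SetFunctor) (F : LiftingFamily T) where
  St : Type
  fin : Finite St
  aI : St
  Ω : St → ℕ
  Δ : St → Set ℕ → OneStep T St
  dfn : ∀ a c, Dfn F (Δ a c)

/-- The colour of a node, relative to a set of proposition letters. -/
def TreeModel.col (M : TreeModel T) (P : Set ℕ) (s : M.S) : Set ℕ := {p | p ∈ P ∧ s ∈ M.V p}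

/-- The children of a node. -/
abbrev TreeModel.Child (M : TreeModel T) (s : M.S) : Type := {t : M.S // M.R s t}

namespace SAut

variable (𝔸 : SAut T F) (P : Set ℕ) (M : TreeModel T)

/-- The family of sets of positions that can be forced in one round of the acceptance game. -/
def fam (v : 𝔸.St × M.S) : Set (Set (𝔸.St × M.S)) :=
  {Y | ∃ U : 𝔸.St → Set (M.Child v.2), 𝔸.Δ v.1 (M.col P v.2) _ (M.σloc v.2) U ∧
    ∀ b t, t ∈ U b → (b, t.1) ∈ Y}

/-- Acceptance, in terms of winning regions. -/
def Acc : Prop := ∃ D, IsRegion 0 (𝔸.fam P M) (fun v => 𝔸.Ω v.1) D ∧ (𝔸.aI, M.root) ∈ D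

theorem upClosed_fam : UpClosed (𝔸.fam P M) := by
  rintro v X Y hXY ⟨U, hU, h⟩
  exact ⟨U, hU, fun b t ht => hXY (h b t ht)⟩

theorem exists_bound : ∃ n, ∀ a, 𝔸.Ω a < n := by
  have := 𝔸.fin
  obtain ⟨n, hn⟩ := (Set.finite_range 𝔸.Ω).bddAbove
  exact ⟨n + 1, fun a => Nat.lt_succ_of_le (hn ⟨a, rfl⟩)⟩

theorem not_acc_iff : ¬ 𝔸.Acc P M ↔
    ∃ D, IsRegion 1 (dualFam (𝔸.fam P M)) (fun v => 𝔸.Ω v.1) D ∧ (𝔸.aI, M.root) ∈ D := by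
  constructor
  · intro h
    obtain ⟨n, hn⟩ := 𝔸.exists_bound
    obtain ⟨D, hD, hD'⟩ := determined (Ω := fun v : 𝔸.St × M.S => 𝔸.Ω v.1) n 0 (𝔸.upClosed_fam P M)
      fun v => .inl (hn v.1)
    exact ⟨_, hD', fun hc => h ⟨D, hD, hc⟩⟩
  · rintro ⟨D, hD, hI⟩ ⟨D', hD', hI'⟩
    exact Set.disjoint_left.1 (hD'.disjoint (𝔸.upClosed_fam P M) hD) hI' hI

variable {P M} in
/-- The positions that can follow `v` when the local valuations are chosen by `U`. -/
def Succ (U : (v : 𝔸.St × M.S) → 𝔸.St → Set (M.Child v.2)) (v w : 𝔸.St × M.S) : Prop :=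
  ∃ h : M.R v.2 w.2, ⟨w.2, h⟩ ∈ U v w.1

theorem acc_iff : 𝔸.Acc P M ↔ ∃ U : (v : 𝔸.St × M.S) → 𝔸.St → Set (M.Child v.2),
    (∀ v, Relation.ReflTransGen (𝔸.Succ U) (𝔸.aI, M.root) v →
      𝔸.Δ v.1 (M.col P v.2) _ (M.σloc v.2) (U v)) ∧
    ∀ f : ℕ → 𝔸.St × M.S, f 0 = (𝔸.aI, M.root) → (∀ n, 𝔸.Succ U (f n) (f (n + 1))) →
      PWins 0 fun i => 𝔸.Ω (f i).1 := by
  constructor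
  · rintro ⟨D, ⟨τ, hτ, hwin⟩, hI⟩
    have h (v : 𝔸.St × M.S) : ∃ U : 𝔸.St → Set (M.Child v.2), v ∈ D →
        𝔸.Δ v.1 (M.col P v.2) _ (M.σloc v.2) U ∧ ∀ b t, t ∈ U b → (b, t.1) ∈ τ v := by
      by_cases hv : v ∈ D
      · obtain ⟨U, hU⟩ := (hτ v hv).1
        exact ⟨U, fun _ => hU⟩
      · exact ⟨fun _ => ∅, fun h => (hv h).elim⟩
    choose U hU using h
    have hsucc : ∀ v ∈ D, ∀ w, 𝔸.Succ U v w → w ∈ τ v := fun v hv w ⟨h, hw⟩ => (hU v hv).2 _ _ hw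
    refine ⟨U, fun v hv => (hU v ?_).1, fun f h0 hs => ?_⟩
    · induction hv with
      | refl => exact hI
      | tail _ h ih => exact (hτ _ ih).2 (hsucc _ ih _ h)
    · have hD : ∀ n, f n ∈ D := fun n => by
        induction n with
        | zero => exact h0 ▸ hI
        | succ n ih => exact (hτ _ ih).2 (hsucc _ ih _ (hs n))
      exact hwin f (hD 0) fun n => hsucc _ (hD n) _ (hs n)
  · rintro ⟨U, hU, hwin⟩
    refine ⟨{v | Relation.ReflTransGen (𝔸.Succ U) (𝔸.aI, M.root) v},
      ⟨fun v => {w | 𝔸.Succ U v w}, fun v hv => ⟨?_, fun w hw => hv.tail hw⟩, fun f h0 hs => ?_⟩, .refl⟩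
    · exact ⟨U v, hU v hv, fun b t ht => ⟨t.2, ht⟩⟩
    · obtain ⟨g, k, hg0, hg, hk⟩ := exists_prefix h0 rfl hs
      exact funext hk ▸ (PWins.shift_iff k).2 (hwin g hg0 hg)

/-- The dual automaton. -/
def dual : SAut T F where
  St := 𝔸.St
  fin := 𝔸.fin
  aI := 𝔸.aI
  Ω a := 𝔸.Ω a + 1
  Δ a c X α V := ∀ V', 𝔸.Δ a c X α V' → ∃ b, ¬ Disjoint (V b) (V' b)
  dfn a c := by
    have := 𝔸.fin
    exact Dfn.all_sets (B := 𝔸.St) (((𝔸.dfn a c).comap_injective Sum.inr_injective).imp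
      (Dfn.any fun b => (Dfn.disjoint (.inl b) (.inr b)).not))

theorem dual_acc_iff : 𝔸.dual.Acc P M ↔ ¬ 𝔸.Acc P M := by
  have hfam : 𝔸.dual.fam P M = dualFam (𝔸.fam P M) := by
    funext v
    ext Y
    constructor
    · rintro ⟨U, hU, hY⟩ ⟨U', hU', hY'⟩
      obtain ⟨b, hb⟩ := hU U' hU'
      obtain ⟨t, ht, ht'⟩ := Set.not_disjoint_iff.1 hb
      exact hY' b t ht' (hY b t ht)
    · intro h
      refine ⟨fun b => {t | (b, t.1) ∈ Y}, fun V' hV' => ?_, fun _ _ => id⟩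
      by_contra hc
      simp only [not_exists, not_not] at hc
      exact h ⟨V', hV', fun b t ht hY => Set.disjoint_left.1 (hc b) hY ht⟩
  rw [not_acc_iff, Acc, hfam]
  refine exists_congr fun D => and_congr_left fun _ => exists_congr fun τ => and_congr_right fun _ =>
    forall_congr' fun f => imp_congr_right fun _ => imp_congr_right fun _ => ?_
  exact PWins.add_one_right

/-- The syntactic automaton of a semantic one. -/
noncomputable def toSO (hP : P.Finite) : SOAutomaton T F where
  P := P
  Pfin := hP
  St := 𝔸.St
  fin := 𝔸.fin
  aI := 𝔸.aI
  Ω := 𝔸.Ω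
  Δ a c := (𝔸.dfn a c).choose
  sentence a c := (𝔸.dfn a c).choose_spec.1

theorem legal_iff (hP : P.Finite) (v : 𝔸.St × M.S) (U : 𝔸.St → Set M.S) :
    (𝔸.toSO P hP).Legal M v.1 v.2 U ↔ (∀ b, U b ⊆ {t | M.R v.2 t}) ∧
      𝔸.Δ v.1 (M.col P v.2) _ (M.σloc v.2) fun b => {t | t.1 ∈ U b} :=
  and_congr_right fun _ => (𝔸.dfn v.1 (M.col P v.2)).choose_spec.2 _ _ _

theorem histPrefix_zero {α : Type} (f : ℕ → α) : histPrefix f 0 = [f 0] := rfl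

theorem histPrefix_succ {α : Type} (f : ℕ → α) (n : ℕ) :
    histPrefix f (n + 1) = f (n + 1) :: histPrefix f n := by
  simp [histPrefix, List.range_succ (n := n + 1)]

theorem accepts_of_acc (hP : P.Finite) (h : 𝔸.Acc P M) : (𝔸.toSO P hP).Accepts M := by
  obtain ⟨U, hU, hwin⟩ := (𝔸.acc_iff P M).1 h
  refine ⟨fun h a => {t | ∃ v ∈ h.head?, 𝔸.Succ U v (a, t)}, fun h a s hr => ?_, fun f h0 hs => ?_⟩
  · have hreach : ∀ h, SOReach (𝔸.toSO P hP) M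
        (fun h a => {t | ∃ v ∈ h.head?, 𝔸.Succ U v (a, t)}) h →
        ∀ v ∈ h.head?, Relation.ReflTransGen (𝔸.Succ U) (𝔸.aI, M.root) v := by
      intro h hr
      induction hr with
      | base =>
        rintro v ⟨⟩
        exact .refl
      | step _ hq ih =>
        rintro v ⟨⟩
        obtain ⟨w, ⟨⟩, hw⟩ := hq
        exact (ih _ rfl).tail hw
    have := hU (a, s) (hreach _ hr _ rfl)
    refine (𝔸.legal_iff P M hP (a, s) _).2 ⟨?_, ?_⟩
    · rintro b t ⟨v, ⟨⟩, h, -⟩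
      exact h
    · convert this using 1
      funext b
      ext t
      constructor
      · rintro ⟨v, ⟨⟩, _, h⟩
        exact h
      · exact fun h => ⟨_, rfl, t.2, h⟩
  · refine hwin f h0 fun n => ?_
    obtain ⟨v, hv, h⟩ := hs n
    cases n with
    | zero =>
      rw [histPrefix_zero] at hv
      cases hv
      exact h
    | succ n =>
      rw [histPrefix_succ] at hv
      cases hv
      exact h

theorem acc_of_accepts (hP : P.Finite) (h : (𝔸.toSO P hP).Accepts M) : 𝔸.Acc P M := by
  by_contra hc
  obtain ⟨D, ⟨τ, hτ, hwin⟩, hI⟩ := (𝔸.not_acc_iff P M).1 hc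
  obtain ⟨st, hleg, hst⟩ := h
  obtain ⟨H, hH0, hHp, hHs⟩ := exists_seq_of_step (a := [(𝔸.aI, M.root)])
    (p := fun h => SOReach (𝔸.toSO P hP) M st h ∧ ∃ v l, h = v :: l ∧ v ∈ D)
    (r := fun h h' => ∃ v l q, h = v :: l ∧ h' = q :: h ∧ q.2 ∈ st h q.1 ∧ q ∈ τ v)
    ⟨.base, _, _, rfl, hI⟩ (by
      rintro _ ⟨hr, v, l, rfl, hv⟩
      obtain ⟨hsub, hΔ⟩ := (𝔸.legal_iff P M hP v _).1 (hleg _ _ _ hr)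
      obtain ⟨hd, hτD⟩ := hτ v hv
      have : ∃ q : 𝔸.St × M.S, q.2 ∈ st (v :: l) q.1 ∧ q ∈ τ v := by
        by_contra hc
        push Not at hc
        exact hd ⟨_, hΔ, fun b t ht hq => hc (b, t.1) ht hq⟩
      obtain ⟨q, hq, hqτ⟩ := this
      exact ⟨q :: v :: l, ⟨.step hr hq, q, _, rfl, hτD hqτ⟩, v, l, q, rfl, rfl, hq, hqτ⟩)
  choose v l q hv hq hqs hqτ using hHs
  have hvq : ∀ n, v (n + 1) = q n := fun n => by
    have := (hv (n + 1)).symm.trans (hq n)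
    exact (List.cons.inj this).1
  have hv0 : v 0 = (𝔸.aI, M.root) := by
    have := (hv 0).symm.trans hH0
    exact (List.cons.inj this).1
  have hpre : ∀ n, H n = histPrefix v n := fun n => by
    induction n with
    | zero =>
      rw [hH0, histPrefix_zero, hv0]
      rfl
    | succ n ih => rw [histPrefix_succ, ← ih, hvq, hq]
  have h1 : PWins 0 fun i => 𝔸.Ω (v i).1 := hst v hv0 fun n => by
    rw [hvq, ← hpre]
    exact hqs n
  have h2 : PWins 1 fun i => 𝔸.Ω (v i).1 := hwin v (hv0 ▸ hI) fun n => by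
    rw [hvq]
    exact hqτ n
  exact h1.not_succ h2

theorem accepts_iff (hP : P.Finite) : (𝔸.toSO P hP).Accepts M ↔ 𝔸.Acc P M :=
  ⟨𝔸.acc_of_accepts P M hP, 𝔸.accepts_of_acc P M hP⟩

end SAut

end SemanticAutomata

/-! ### Trees -/

section Tree

variable {S : Type} {R : S → S → Prop}

theorem RPath.snoc {s t w : S} {l : List S} (h : RPath R s t l) (hw : R t w) :
    RPath R s w (l ++ [w]) := by
  induction h with
  | nil s => exact .cons hw (.nil w)
  | cons h _ ih => exact .cons h (ih hw)

theorem RPath.reflTransGen {s t : S} {l : List S} (h : RPath R s t l) :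
    Relation.ReflTransGen R s t := by
  induction h with
  | nil s => exact .refl
  | cons h _ ih => exact .head h ih

theorem RPath.unique {s t t' : S} {l : List S} (h : RPath R s t l) (h' : RPath R s t' l) :
    t = t' := by
  induction h with
  | nil s => cases h'; rfl
  | cons _ _ ih => cases h' with | cons _ h' => exact ih h'

variable {T : SetFunctor} (M : TreeModel T)

theorem TreeModel.reachable (s : M.S) : Relation.ReflTransGen M.R M.root s :=
  (M.tree s).exists.choose_spec.reflTransGen

theorem TreeModel.not_R_root (s : M.S) : ¬ M.R s M.root := fun h => by
  obtain ⟨l, hl⟩ := (M.tree s).exists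
  have := (M.tree M.root).unique (hl.snoc h) (.nil _)
  simp at this

theorem TreeModel.parent_unique {s s' t : M.S} (h : M.R s t) (h' : M.R s' t) : s = s' := by
  obtain ⟨l, hl⟩ := (M.tree s).exists
  obtain ⟨l', hl'⟩ := (M.tree s').exists
  have := (M.tree t).unique (hl.snoc h) (hl'.snoc h')
  rw [List.append_cancel_right this] at hl
  exact hl.unique hl'

end Tree

/-! ### Closure properties of automata -/

section Embedding

variable {Pos Pos' : Type} {e : ℕ} {F : Pos → Set (Set Pos)} {F' : Pos' → Set (Set Pos')}
  {Ω : Pos → ℕ} {Ω' : Pos' → ℕ} {ι : Pos → Pos'}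

theorem IsRegion.image (hι : ι.Injective) (hF : ∀ v Y, Y ∈ F' (ι v) ↔ ι ⁻¹' Y ∈ F v)
    (hΩ : ∀ v, Ω' (ι v) = Ω v) {D : Set Pos} (h : IsRegion e F Ω D) :
    IsRegion e F' Ω' (ι '' D) := by
  obtain ⟨τ, hτ, hw⟩ := h
  refine ⟨fun v' => {w' | ∃ v w, v' = ι v ∧ w' = ι w ∧ w ∈ τ v}, ?_, fun f h0 hs => ?_⟩
  · rintro _ ⟨v, hv, rfl⟩
    refine ⟨(hF _ _).2 ?_, ?_⟩
    · convert (hτ v hv).1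
      ext w
      constructor
      · rintro ⟨v₁, w₁, h1, h2, h⟩
        rwa [hι h1, hι h2]
      · exact fun h => ⟨v, w, rfl, rfl, h⟩
    · rintro _ ⟨v₁, w, h1, rfl, h⟩
      obtain rfl := hι h1
      exact ⟨w, (hτ v hv).2 h, rfl⟩
  · choose g g' hg hg' hgs using hs
    obtain ⟨v, hv, h0⟩ := h0
    have heq : ∀ n, g' n = g (n + 1) := fun n => hι ((hg' n).symm.trans (hg (n + 1)))
    have := hw g (by rwa [← hι (h0.trans (hg 0))]) fun n => heq n ▸ hgs n
    simpa only [hg, hΩ] using this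

theorem IsRegion.preimage (hF : ∀ v Y, Y ∈ F' (ι v) ↔ ι ⁻¹' Y ∈ F v)
    (hΩ : ∀ v, Ω' (ι v) = Ω v) {D : Set Pos'} (h : IsRegion e F' Ω' D) :
    IsRegion e F Ω (ι ⁻¹' D) := by
  obtain ⟨τ, hτ, hw⟩ := h
  refine ⟨fun v => ι ⁻¹' τ (ι v), fun v hv => ⟨(hF _ _).1 (hτ _ hv).1, fun w hw' => (hτ _ hv).2 hw'⟩,
    fun f h0 hs => ?_⟩
  simpa only [hΩ] using hw (fun n => ι (f n)) h0 hs

theorem IsRegion.insert {D : Set Pos} (h : IsRegion e F Ω D) {v : Pos} (hF : UpClosed F)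
    {Y : Set Pos} (hY : Y ∈ F v) (hYD : Y ⊆ D) : IsRegion e F Ω (D ∪ {v}) := by
  by_cases hv : v ∈ D
  · rwa [Set.union_eq_self_of_subset_right (Set.singleton_subset_iff.2 hv)]
  · refine h.extend (fun _ => D) ?_ fun f hf hs => ?_
    · rintro w rfl
      exact ⟨hF _ _ _ hYD hY, Set.subset_union_left⟩
    · have h1 : f 1 = v := hf 1
      exact (hv (h1 ▸ hs 0)).elim

end Embedding

section Closure

variable {T : SetFunctor} {F : LiftingFamily T}

namespace SAut

theorem mem_fam_of_embed {𝔸 𝔹 : SAut T F} {e : 𝔸.St → 𝔹.St} (he : e.Injective) {a : 𝔸.St}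
    {b : 𝔹.St} (h : ∀ c X α V, 𝔹.Δ b c X α V ↔ 𝔸.Δ a c X α fun a' => V (e a'))
    (P : Set ℕ) (M : TreeModel T) (s : M.S) (Y : Set (𝔹.St × M.S)) :
    Y ∈ 𝔹.fam P M (b, s) ↔ Prod.map e id ⁻¹' Y ∈ 𝔸.fam P M (a, s) := by
  constructor
  · rintro ⟨U, hU, hY⟩
    exact ⟨fun a' => U (e a'), (h _ _ _ _).1 hU, fun a' t ht => hY _ t ht⟩
  · rintro ⟨U, hU, hY⟩
    refine ⟨fun b' => {t | ∃ a', b' = e a' ∧ t ∈ U a'}, (h _ _ _ _).2 ?_, ?_⟩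
    · simpa [he.eq_iff] using hU
    · rintro _ t ⟨a', rfl, ht⟩
      exact hY a' t ht

/-- The disjunction of two automata. -/
def disj (𝔸 𝔹 : SAut T F) : SAut T F where
  St := Option (𝔸.St ⊕ 𝔹.St)
  fin := by
    have := 𝔸.fin
    have := 𝔹.fin
    infer_instance
  aI := none
  Ω a := a.elim 0 (Sum.elim 𝔸.Ω 𝔹.Ω)
  Δ a c X α V := match a with
    | none => 𝔸.Δ 𝔸.aI c X α (fun a => V (some (.inl a))) ∨
        𝔹.Δ 𝔹.aI c X α (fun a => V (some (.inr a)))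
    | some (.inl a) => 𝔸.Δ a c X α (fun a => V (some (.inl a)))
    | some (.inr a) => 𝔹.Δ a c X α (fun a => V (some (.inr a)))
  dfn a c := by
    have hl := (Option.some_injective _).comp (Sum.inl_injective (α := 𝔸.St) (β := 𝔹.St))
    have hr := (Option.some_injective _).comp (Sum.inr_injective (α := 𝔸.St) (β := 𝔹.St))
    match a with
    | none => exact ((𝔸.dfn _ c).comap_injective hl).or ((𝔹.dfn _ c).comap_injective hr)
    | some (.inl a) => exact (𝔸.dfn a c).comap_injective hl
    | some (.inr a) => exact (𝔹.dfn a c).comap_injective hr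

theorem acc_of_entry {𝔸 𝔹 : SAut T F} {e : 𝔸.St → 𝔹.St} (he : e.Injective)
    (h : ∀ a c X α V, 𝔹.Δ (e a) c X α V ↔ 𝔸.Δ a c X α fun a' => V (e a'))
    (hΩ : ∀ a, 𝔹.Ω (e a) = 𝔸.Ω a)
    (hI : ∀ c X α V, 𝔸.Δ 𝔸.aI c X α (fun a' => V (e a')) → 𝔹.Δ 𝔹.aI c X α V)
    {P : Set ℕ} {M : TreeModel T} (hacc : 𝔸.Acc P M) : 𝔹.Acc P M := by
  obtain ⟨D, hD, hDI⟩ := hacc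
  have hinj : (Prod.map e (id : M.S → M.S)).Injective := he.prodMap Function.injective_id
  have hD' := hD.image (F' := 𝔹.fam P M) (Ω' := fun v => 𝔹.Ω v.1) hinj
    (fun v Y => mem_fam_of_embed he (h v.1) P M v.2 Y) fun v => hΩ v.1
  obtain ⟨τ, hτ, -⟩ := hD
  obtain ⟨U, hU, hY⟩ := (hτ _ hDI).1
  refine ⟨_, hD'.insert (𝔹.upClosed_fam P M) (v := (𝔹.aI, M.root)) (Y := Prod.map e id '' D)
    ⟨fun b' => {t | ∃ a', b' = e a' ∧ t ∈ U a'}, hI _ _ _ _ ?_, ?_⟩ subset_rfl, .inr rfl⟩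
  · simpa [he.eq_iff] using hU
  · rintro _ t ⟨a', rfl, ht⟩
    exact ⟨(a', t.1), (hτ _ hDI).2 (hY a' t ht), rfl⟩

theorem disj_acc_iff (𝔸 𝔹 : SAut T F) (P : Set ℕ) (M : TreeModel T) :
    (𝔸.disj 𝔹).Acc P M ↔ 𝔸.Acc P M ∨ 𝔹.Acc P M := by
  have hl := (Option.some_injective _).comp (Sum.inl_injective (α := 𝔸.St) (β := 𝔹.St))
  have hr := (Option.some_injective _).comp (Sum.inr_injective (α := 𝔸.St) (β := 𝔹.St))
  constructor
  · rintro ⟨D, hD, hI⟩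
    have hA : IsRegion 0 (𝔸.fam P M) (fun v => 𝔸.Ω v.1) _ :=
      hD.preimage (ι := Prod.map (some ∘ Sum.inl) id)
        (fun (v : 𝔸.St × M.S) Y =>
          mem_fam_of_embed (𝔹 := 𝔸.disj 𝔹) hl (fun _ _ _ _ => Iff.rfl) P M v.2 Y) fun _ => rfl
    have hB : IsRegion 0 (𝔹.fam P M) (fun v => 𝔹.Ω v.1) _ :=
      hD.preimage (ι := Prod.map (some ∘ Sum.inr) id)
        (fun (v : 𝔹.St × M.S) Y =>
          mem_fam_of_embed (𝔹 := 𝔸.disj 𝔹) hr (fun _ _ _ _ => Iff.rfl) P M v.2 Y) fun _ => rfl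
    obtain ⟨τ, hτ, -⟩ := hD
    obtain ⟨⟨U, hU | hU, hY⟩, hsub⟩ := hτ _ hI
    · exact .inl ⟨_, hA.insert (𝔸.upClosed_fam P M) (v := (𝔸.aI, M.root))
        ⟨_, hU, fun b t ht => hsub (hY _ t ht)⟩ subset_rfl, .inr rfl⟩
    · exact .inr ⟨_, hB.insert (𝔹.upClosed_fam P M) (v := (𝔹.aI, M.root))
        ⟨_, hU, fun b t ht => hsub (hY _ t ht)⟩ subset_rfl, .inr rfl⟩
  · rintro (h | h)
    · exact acc_of_entry (𝔸 := 𝔸) (𝔹 := 𝔸.disj 𝔹) hl (fun _ _ _ _ _ => Iff.rfl) (fun _ => rfl)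
        (fun _ _ _ _ h => Or.inl h) h
    · exact acc_of_entry (𝔸 := 𝔹) (𝔹 := 𝔸.disj 𝔹) hr (fun _ _ _ _ _ => Iff.rfl) (fun _ => rfl)
        (fun _ _ _ _ h => Or.inr h) h

/-- The automaton checking a property of the colour of the root. -/
def rootAut (F : LiftingFamily T) (Ψ : Set ℕ → Prop) : SAut T F where
  St := Unit
  fin := inferInstance
  aI := ()
  Ω _ := 0
  Δ _ c _ _ _ := Ψ c
  dfn _ c := Dfn.const (Ψ c)

theorem rootAut_acc_iff (Ψ : Set ℕ → Prop) (P : Set ℕ) (M : TreeModel T) :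
    (rootAut F Ψ).Acc P M ↔ Ψ (M.col P M.root) := by
  rw [acc_iff]
  constructor
  · rintro ⟨U, hU, -⟩
    exact hU _ .refl
  · intro h
    refine ⟨fun _ _ => ∅, fun v hv => ?_, fun f h0 hs => ?_⟩
    · rcases hv.cases_tail with heq | ⟨w, -, _, hw⟩
      · obtain rfl := heq
        exact h
      · exact hw.elim
    · obtain ⟨_, h⟩ := hs 0
      exact h.elim

/-- The automaton checking at every node a condition on properties of the colours of the
children. -/
def localAut {K : Type} [Finite K] (Φ : Set ℕ → OneStep T K) (hΦ : ∀ c, Dfn F (Φ c))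
    (Ψ : K → Set ℕ → Prop) : SAut T F where
  St := Option K
  fin := inferInstance
  aI := none
  Ω _ := 0
  Δ a c X α V := match a with
    | none => Φ c X α (fun k => V (some k)) ∧ ∀ x, x ∈ V none
    | some k => Ψ k c
  dfn a c := by
    match a with
    | none =>
      have h : Dfn F fun X (_ : T.obj X) (V : Option K → Set X) => ∀ x, x ∈ V none :=
        Dfn.pointwise fun A => none ∈ A
      exact ((hΦ c).comap_injective (Option.some_injective K)).and h
    | some k => exact Dfn.const (Ψ k c)

theorem localAut_acc_iff {K : Type} [Finite K] (Φ : Set ℕ → OneStep T K)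
    (hΦ : ∀ c, Dfn F (Φ c)) (Ψ : K → Set ℕ → Prop) (P : Set ℕ) (M : TreeModel T) :
    (localAut Φ hΦ Ψ).Acc P M ↔ ∀ s, ∃ U : K → Set (M.Child s),
      Φ (M.col P s) _ (M.σloc s) U ∧ ∀ k, ∀ t ∈ U k, Ψ k (M.col P t.1) := by
  rw [acc_iff]
  constructor
  · rintro ⟨U, hU, -⟩ s
    have hs : Relation.ReflTransGen ((localAut Φ hΦ Ψ).Succ U) (none, M.root) (none, s) := by
      induction M.reachable s with
      | refl => exact .refl
      | tail _ h ih => exact ih.tail ⟨h, (hU _ ih).2 _⟩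
    exact ⟨fun k => U (none, s) (some k), (hU _ hs).1,
      fun k t ht => hU (some k, t.1) (hs.tail ⟨t.2, ht⟩)⟩
  · intro h
    choose U hU hΨ using h
    refine ⟨fun v a => match v.1, a with
      | none, none => Set.univ
      | none, some k => U v.2 k
      | some _, _ => ∅, fun v hv => ?_, fun f h0 hs => ?_⟩
    · rcases hv.cases_tail with heq | ⟨⟨a, s⟩, -, _, hw⟩
      · obtain rfl := heq
        exact ⟨hU _, fun _ => trivial⟩
      · obtain ⟨b, t⟩ := v
        match a, b with
        | none, none => exact ⟨hU _, fun _ => trivial⟩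
        | none, some k => exact hΨ _ _ _ hw
        | some _, _ => exact hw.elim
    · exact .of_eventually_le (n := 0) (by simp) (.of_forall fun _ => rfl) (.of_forall fun _ => le_rfl)

end SAut

end Closure

/-! ### Projection -/

section Projection

variable {T : SetFunctor} {F : LiftingFamily T}

/-- Reset the proposition letter `p` in the colour `c` to the truth value of `i`. -/
def setLetter (p : ℕ) (i : Prop) (c : Set ℕ) : Set ℕ := {n | n = p ∧ i ∨ n ≠ p ∧ n ∈ c}

/-- Reinterpret a proposition letter in a tree model. -/
noncomputable abbrev TreeModel.update (M : TreeModel T) (p : ℕ) (Z : Set M.S) : TreeModel T :=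
  { M with V := updW M.V p Z }

theorem TreeModel.col_update (M : TreeModel T) (P : Set ℕ) (p : ℕ) (Z : Set M.S) (s : M.S) :
    (M.update p Z).col (insert p P) s = setLetter p (s ∈ Z) (M.col P s) := by
  ext n
  by_cases hn : n = p <;> simp [TreeModel.col, TreeModel.update, updW, setLetter, hn]

/-- The restriction of a set of edges to those that start in `X`. -/
def edgesFrom {A : Type} (X : Set A) (D : Set (A × A)) (a a' : A) : Prop := a ∈ X ∧ (a, a') ∈ D

/-- The state of the projection automaton after reading the set of edges `D`. -/
def projNext {A Q : Type} (δ : Q → (A → A → Prop) → Q) (b : Q × Set A) (D : Set (A × A)) :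
    Q × Set A :=
  (δ b.1 (edgesFrom b.2 D), {a' | ∃ a, edgesFrom b.2 D a a'})

namespace SAut

/-- The automaton that guesses an interpretation of `p`, runs `𝔸` with all its states in parallel,
and feeds the traces to a deterministic automaton `(Q, q₀, δ, Ω)`. -/
def proj (𝔸 : SAut T F) (p : ℕ) {Q : Type} [Finite Q] (q₀ : Q)
    (δ : Q → (𝔸.St → 𝔸.St → Prop) → Q) (Ω : Q → ℕ) : SAut T F where
  St := Q × Set 𝔸.St
  fin := by
    have := 𝔸.fin
    infer_instance
  aI := (q₀, {𝔸.aI})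
  Ω b := Ω b.1
  Δ b c X α V := ∃ (i : Prop) (W : 𝔸.St × 𝔸.St → Set X),
    (∀ a, a ∈ b.2 → 𝔸.Δ a (setLetter p i c) X α fun a' => W (a, a')) ∧
      ∀ x b', x ∈ V b' ↔ b' = projNext δ b {e | x ∈ W e}
  dfn b c := by
    have := 𝔸.fin
    refine Dfn.any fun i => Dfn.ex (Q := fun X α (V : (Q × Set 𝔸.St) ⊕ (𝔸.St × 𝔸.St) → Set X) =>
      (∀ a, a ∈ b.2 → 𝔸.Δ a (setLetter p i c) X α fun a' => V (.inr (a, a'))) ∧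
        ∀ x b', x ∈ V (.inl b') ↔ b' = projNext δ b {e | x ∈ V (.inr e)}) ?_
    have h (a : 𝔸.St) : (fun a' : 𝔸.St => (Sum.inr (a, a') :
        (Q × Set 𝔸.St) ⊕ (𝔸.St × 𝔸.St))).Injective := fun a' a'' h => by simpa using h
    exact (Dfn.all fun a => (Dfn.const (a ∈ b.2)).imp ((𝔸.dfn a _).comap_injective (h a))).and
      (Dfn.pointwise fun A => ∀ b', Sum.inl b' ∈ A ↔ b' = projNext δ b {e | Sum.inr e ∈ A})

variable {𝔸 : SAut T F} {p : ℕ} {Q : Type} [Finite Q] {q₀ : Q}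
  {δ : Q → (𝔸.St → 𝔸.St → Prop) → Q} {Ω : Q → ℕ}

theorem exists_acc_update_of_proj_acc
    (hQ : ∀ (r : ℕ → 𝔸.St → 𝔸.St → Prop) (ρ : ℕ → Q), ρ 0 = q₀ → (∀ k, ρ (k + 1) = δ (ρ k) (r k)) →
      (PWins 0 fun i => Ω (ρ i)) → ∀ t : ℕ → 𝔸.St, t 0 = 𝔸.aI → (∀ i, r i (t i) (t (i + 1))) →
        PWins 0 fun i => 𝔸.Ω (t i))
    {P : Set ℕ} {M : TreeModel T} (h : (𝔸.proj p q₀ δ Ω).Acc P M) :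
    ∃ Z, 𝔸.Acc (insert p P) (M.update p Z) := by
  obtain ⟨U, hU, hwin⟩ := (acc_iff _ _ _).1 h
  choose i W hW hV using hU
  have huniq (s : M.S) : ∃! b, Relation.ReflTransGen ((𝔸.proj p q₀ δ Ω).Succ U)
      ((𝔸.proj p q₀ δ Ω).aI, M.root) (b, s) := by
    induction M.reachable s with
    | refl =>
      refine ⟨_, .refl, fun b hb => ?_⟩
      obtain heq | ⟨v, -, hR, -⟩ := hb.cases_tail
      · exact congrArg Prod.fst heq
      · exact (M.not_R_root _ hR).elim
    | @tail s t _ hst ih =>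
      obtain ⟨b, hb, hu⟩ := ih
      refine ⟨projNext δ b {e | ⟨t, hst⟩ ∈ W (b, s) hb e},
        hb.tail ⟨hst, (hV (b, s) hb ⟨t, hst⟩ _).2 rfl⟩, fun b' hb' => ?_⟩
      obtain heq | ⟨⟨b₁, s₁⟩, hb₁, hR, h⟩ := hb'.cases_tail
      · obtain rfl : t = M.root := congrArg Prod.snd heq
        exact (M.not_R_root _ hst).elim
      · obtain rfl : s₁ = s := M.parent_unique hR hst
        obtain rfl := hu _ hb₁
        exact (hV _ hb ⟨t, hst⟩ _).1 h
  choose b hb hu using huniq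
  have hb0 : b M.root = (q₀, {𝔸.aI}) := (hu _ _ .refl).symm
  have hbs {s t : M.S} (h : M.R s t) :
      b t = projNext δ (b s) {e | ⟨t, h⟩ ∈ W (b s, s) (hb s) e} :=
    (hu _ _ ((hb s).tail ⟨h, (hV (b s, s) (hb s) ⟨t, h⟩ _).2 rfl⟩)).symm
  set Z : Set M.S := {s | i (b s, s) (hb s)} with hZ
  set UA : (v : 𝔸.St × M.S) → 𝔸.St → Set (M.Child v.2) :=
    fun v a' => W (b v.2, v.2) (hb v.2) (v.1, a') with hUA
  have hmem : ∀ v, Relation.ReflTransGen (𝔸.Succ (M := M.update p Z) UA) (𝔸.aI, M.root) v →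
      v.1 ∈ (b v.2).2 := fun v hv => by
    induction hv with
    | refl => simp [hb0]
    | tail _ h ih =>
      obtain ⟨hR, h⟩ := h
      rw [hbs hR]
      exact ⟨_, ih, h⟩
  refine ⟨Z, (acc_iff _ _ _).2 ⟨UA, fun v hv => ?_, fun f h0 hs => ?_⟩⟩
  · rw [M.col_update]
    exact hW _ (hb v.2) v.1 (hmem v hv)
  · have hreach : ∀ n, Relation.ReflTransGen (𝔸.Succ (M := M.update p Z) UA) (𝔸.aI, M.root) (f n) :=
      fun n => by
        induction n with
        | zero => exact h0 ▸ .refl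
        | succ n ih => exact ih.tail (hs n)
    choose hR hs using hs
    have hroot : (f 0).2 = M.root := congrArg Prod.snd h0
    refine hQ (fun n => edgesFrom (b (f n).2).2 {e | ⟨(f (n + 1)).2, hR n⟩ ∈ W _ (hb (f n).2) e})
      (fun n => (b (f n).2).1) ?_ (fun n => ?_) ?_ (fun n => (f n).1) (congrArg Prod.fst h0)
      fun n => ⟨hmem _ (hreach n), show _ ∈ UA _ _ from hs n⟩
    · rw [hroot, hb0]
    · exact congrArg Prod.fst (hbs (hR n))
    · refine hwin (fun n => (b (f n).2, (f n).2)) ?_ fun n => ⟨hR n, ?_⟩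
      · change (b (f 0).2, (f 0).2) = _
        rw [hroot, hb0]
        rfl
      · exact (hV _ (hb (f n).2) ⟨(f (n + 1)).2, hR n⟩ _).2 (hbs (hR n))

theorem proj_acc_of_acc_update
    (hQ : ∀ (r : ℕ → 𝔸.St → 𝔸.St → Prop) (ρ : ℕ → Q), ρ 0 = q₀ → (∀ k, ρ (k + 1) = δ (ρ k) (r k)) →
      (∀ t : ℕ → 𝔸.St, t 0 = 𝔸.aI → (∀ i, r i (t i) (t (i + 1))) → PWins 0 fun i => 𝔸.Ω (t i)) →
        PWins 0 fun i => Ω (ρ i))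
    {P : Set ℕ} {M : TreeModel T} {Z : Set M.S} (h : 𝔸.Acc (insert p P) (M.update p Z)) :
    (𝔸.proj p q₀ δ Ω).Acc P M := by
  obtain ⟨UA, hU, hwin⟩ := (acc_iff _ _ _).1 h
  let D (s : M.S) (x : M.Child s) : Set (𝔸.St × 𝔸.St) := {e | x ∈ UA (e.1, s) e.2}
  let U (v : (Q × Set 𝔸.St) × M.S) (b' : Q × Set 𝔸.St) : Set (M.Child v.2) :=
    {x | b' = projNext δ v.1 (D v.2 x)}
  have hmem : ∀ v, Relation.ReflTransGen ((𝔸.proj p q₀ δ Ω).Succ U)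
      ((𝔸.proj p q₀ δ Ω).aI, M.root) v → ∀ a ∈ v.1.2,
        Relation.ReflTransGen (𝔸.Succ (M := M.update p Z) UA) (𝔸.aI, M.root) (a, v.2) := by
    intro v hv
    induction hv with
    | refl =>
      rintro _ rfl
      exact .refl
    | @tail v w _ h ih =>
      obtain ⟨hR, h⟩ := h
      intro a' ha'
      have h : w.1 = projNext δ v.1 (D v.2 ⟨w.2, hR⟩) := h
      rw [h] at ha'
      obtain ⟨a, ha, he⟩ := ha'
      exact (ih a ha).tail ⟨hR, he⟩
  refine (acc_iff _ _ _).2 ⟨U, fun v hv => ?_, fun f h0 hs => ?_⟩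
  · refine ⟨v.2 ∈ Z, fun e => UA (e.1, v.2) e.2, fun a ha => ?_, fun x b' => Iff.rfl⟩
    have := hU (a, v.2) (hmem v hv a ha)
    rwa [M.col_update] at this
  · choose hR hs using hs
    have hs : ∀ n, (f (n + 1)).1 = projNext δ (f n).1 (D (f n).2 ⟨(f (n + 1)).2, hR n⟩) := hs
    refine hQ (fun n => edgesFrom (f n).1.2 (D (f n).2 ⟨(f (n + 1)).2, hR n⟩)) (fun n => (f n).1.1)
      (congrArg (fun v => v.1.1) h0) (fun n => congrArg Prod.fst (hs n)) fun t ht0 ht => ?_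
    exact hwin (fun n => (t n, (f n).2)) (Prod.ext ht0 (congrArg (fun v => v.2) h0))
      fun n => ⟨hR n, (ht n).2⟩

theorem exists_proj (𝔸 : SAut T F) (p : ℕ) (P : Set ℕ) : ∃ 𝔹 : SAut T F, ∀ M : TreeModel T,
    𝔹.Acc P M ↔ ∃ Z, 𝔸.Acc (insert p P) (M.update p Z) := by
  have := 𝔸.fin
  obtain ⟨Q, _, q₀, δ, Ω, hQ⟩ := exists_trace_automaton 𝔸.St 𝔸.Ω 𝔸.aI
  exact ⟨𝔸.proj p q₀ δ Ω, fun M =>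
    ⟨exists_acc_update_of_proj_acc fun r ρ h0 hs => (hQ r ρ h0 hs).1,
      fun ⟨_, h⟩ => proj_acc_of_acc_update (fun r ρ h0 hs => (hQ r ρ h0 hs).2) h⟩⟩

end SAut

end Projection

/-! ### From formulas to automata -/

section Translation

variable {T : SetFunctor} {F : LiftingFamily T}

theorem TreeModel.mem_col {M : TreeModel T} {P : Set ℕ} {p : ℕ} (hp : p ∈ P) (s : M.S) :
    p ∈ M.col P s ↔ s ∈ M.V p := and_iff_right hp

theorem TreeModel.σ_mem_iff (M : TreeModel T) {n : ℕ} (l : PredLifting T n) (hl : l.Mono) (s : M.S)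
    (V : Fin n → Set M.S) : M.σ s ∈ l.app M.S V ↔
      ∃ U : Fin n → Set (M.Child s), M.σloc s ∈ l.app _ U ∧ ∀ k, ∀ t ∈ U k, t.1 ∈ V k := by
  have h : M.σ s ∈ l.app M.S V ↔ M.σloc s ∈ l.app (M.Child s) fun k => Subtype.val ⁻¹' V k := by
    rw [l.natural, Set.mem_preimage, M.σloc_spec]
  rw [h]
  exact ⟨fun h => ⟨_, h, fun _ _ => id⟩, fun ⟨U, hU, hUV⟩ => hl _ _ _ hUV hU⟩

theorem TreeModel.eq_singleton_root_iff (M : TreeModel T) (Z : Set M.S) :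
    Z = {M.root} ↔ M.root ∈ Z ∧ ∀ s t, M.R s t → t ∉ Z := by
  constructor
  · rintro rfl
    exact ⟨rfl, by rintro s _ h rfl; exact M.not_R_root s h⟩
  · rintro ⟨hr, h⟩
    refine (Set.eq_singleton_iff_unique_mem.2 ⟨hr, fun t ht => ?_⟩)
    obtain heq | ⟨s, -, hst⟩ := (M.reachable t).cases_tail
    · exact heq
    · exact (h s t hst ht).elim

theorem MSOForm.exists_aut (φ : MSOForm F) {P : Set ℕ} (hP : φ.fv ⊆ P) :
    ∃ 𝔸 : SAut T F, ∀ M : TreeModel T, 𝔸.Acc P M ↔ φ.sat M.σ M.V M.root := by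
  induction φ generalizing P with
  | bot => exact ⟨.rootAut F fun _ => False, fun M => SAut.rootAut_acc_iff _ P M⟩
  | sr p =>
    have hp : p ∈ P := hP rfl
    refine ⟨((SAut.rootAut F fun c => p ∈ c).dual.disj (SAut.localAut (K := Unit)
      (fun _ X _ V => ∀ x, x ∈ V ()) (fun _ => Dfn.pointwise fun A => () ∈ A)
        fun _ c => p ∉ c).dual).dual, fun M => ?_⟩
    rw [SAut.dual_acc_iff, SAut.disj_acc_iff, SAut.dual_acc_iff, SAut.dual_acc_iff, ← not_and_or,
      not_not, SAut.rootAut_acc_iff, SAut.localAut_acc_iff, M.mem_col hp]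
    refine Iff.trans ?_ (M.eq_singleton_root_iff (M.V p)).symm
    refine and_congr_right fun _ => forall_congr' fun s => ⟨?_, fun h => ?_⟩
    · rintro ⟨U, hU, h⟩ t hst ht
      exact h () ⟨t, hst⟩ (hU _) ⟨hp, ht⟩
    · exact ⟨fun _ => Set.univ, fun _ => trivial, fun _ t _ ht => h _ t.2 ht.2⟩
  | subset p q =>
    have hp : p ∈ P := hP (.inl rfl)
    have hq : q ∈ P := hP (.inr rfl)
    refine ⟨.localAut (K := Empty) (fun c _ _ _ => p ∈ c → q ∈ c) (fun _ => Dfn.const _)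
      fun _ _ => True, fun M => ?_⟩
    rw [SAut.localAut_acc_iff]
    refine forall_congr' fun s => ?_
    rw [M.mem_col hp, M.mem_col hq]
    exact ⟨fun ⟨_, h, _⟩ => h, fun h => ⟨fun _ => ∅, h, fun _ _ _ => trivial⟩⟩
  | lift i p qs =>
    have hp : p ∈ P := hP (.inl rfl)
    have hq (k) : qs k ∈ P := hP (.inr ⟨k, rfl⟩)
    refine ⟨.localAut (K := Fin (F.ar i)) (fun c X α V => p ∈ c → α ∈ (F.lf i).app X V)
      (fun c => (Dfn.const (p ∈ c)).imp (Dfn.lift i id)) fun k c => qs k ∈ c, fun M => ?_⟩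
    rw [SAut.localAut_acc_iff]
    refine forall_congr' fun s => ?_
    simp only [M.mem_col hp, M.mem_col (hq _)]
    rw [M.σ_mem_iff _ (F.mono i)]
    by_cases hs : s ∈ M.V p
    · simp [hs]
    · simp only [hs, false_imp_iff, true_and, iff_true]
      exact ⟨fun _ => ∅, fun _ _ h => h.elim⟩
  | or φ ψ ihφ ihψ =>
    obtain ⟨𝔸, h𝔸⟩ := ihφ (Set.subset_union_left.trans hP)
    obtain ⟨𝔹, h𝔹⟩ := ihψ (Set.subset_union_right.trans hP)
    exact ⟨𝔸.disj 𝔹, fun M => (𝔸.disj_acc_iff 𝔹 P M).trans (or_congr (h𝔸 M) (h𝔹 M))⟩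
  | neg φ ih =>
    obtain ⟨𝔸, h𝔸⟩ := ih hP
    exact ⟨𝔸.dual, fun M => (𝔸.dual_acc_iff P M).trans (not_congr (h𝔸 M))⟩
  | ex p φ ih =>
    obtain ⟨𝔸, h𝔸⟩ := ih (P := insert p P) (Set.sdiff_singleton_subset_iff.1 hP)
    obtain ⟨𝔹, h𝔹⟩ := 𝔸.exists_proj p P
    exact ⟨𝔹, fun M => (h𝔹 M).trans (exists_congr fun Z => h𝔸 (M.update p Z))⟩

end Translation

/-- **Automata for coalgebraic MSO.** Every formula of `MSO_Λ` with free
variables contained in a finite set `P` is equivalent, over `T`-tree models, to a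
`P`-chromatic second-order `Λ`-automaton. -/
theorem mso_to_automaton (T : SetFunctor) (F : LiftingFamily T)
    (φ : MSOForm F) (P : Set ℕ) (hP : P.Finite) (hfv : φ.fv ⊆ P) :
    ∃ aut : SOAutomaton T F, aut.P = P ∧
      ∀ M : TreeModel T, aut.Accepts M ↔ φ.sat M.σ M.V M.root := by
  obtain ⟨𝔸, h𝔸⟩ := φ.exists_aut hfv
  exact ⟨𝔸.toSO P hP, rfl, fun M => (𝔸.accepts_iff P M hP).trans (h𝔸 M)⟩
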